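/- A permutation w contains at least one of the patterns 53241, 52341, 52431 if and only if at least one of the following interval patterns embeds in w: a member of family A, or [21354, 52341], or [421653, 642531], or [326154, 635241]. -/

import Mathlib

/-- `w` contains the (classical) pattern given in one-line notation by the list `v`. -/
def Contains {n : ℕ} (w : Equiv.Perm (Fin n)) (v : List ℕ) : Prop :=
  ∃ f : Fin v.length → Fin n, StrictMono f ∧
    ∀ j k : Fin v.length, w (f j) < w (f k) ↔ v.get j < v.get k

/-- `ℓ(u)`: the number of inversions of `u`. -/
def ell {m : ℕ} (u : Equiv.Perm (Fin m)) : ℕ :=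
  (Finset.univ.filter fun ij : Fin m × Fin m => ij.1 < ij.2 ∧ u ij.2 < u ij.1).card

/-- The Bruhat order on `S_m`: the reflexive–transitive closure of `u < u·t` for `t` a
transposition with `ℓ(u·t) > ℓ(u)`. -/
def BruhatLE {m : ℕ} (u v : Equiv.Perm (Fin m)) : Prop :=
  Relation.ReflTransGen
    (fun a b => ∃ i j : Fin m, i ≠ j ∧ b = a * Equiv.swap i j ∧ ell a < ell b) u v

/-- One-line notation value of a permutation of `Fin m` at a position `k ∈ {1,…,m}`;
junk value `0` outside that range. -/
def pval {m : ℕ} (u : Equiv.Perm (Fin m)) (k : ℕ) : ℕ :=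
  if h : 1 ≤ k ∧ k ≤ m then ((u ⟨k - 1, by omega⟩ : Fin m) : ℕ) + 1 else 0

/-- The one-line notation of `u` is the list `L`. -/
def OneLine {m : ℕ} (u : Equiv.Perm (Fin m)) (L : List ℕ) : Prop :=
  m = L.length ∧ ∀ (k : ℕ) (h : k < L.length), pval u (k + 1) = L.get ⟨k, h⟩

/-- The interval pattern `[u,v]` (with `u ≤ v` in `S_m`) embeds in `w ∈ S_n`:  there are
positions `f` (strictly increasing) at which `w` is in the relative order of `v`, such
that, letting `x` be the permutation agreeing with `w` off these positions and taking the
same set of values at these positions but in the relative order of `u`, the Bruhat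
intervals `[u,v]` and `[x,w]` are isomorphic as posets. -/
def IntervalEmbeds {m n : ℕ} (u v : Equiv.Perm (Fin m)) (w : Equiv.Perm (Fin n)) :
    Prop :=
  BruhatLE u v ∧
  ∃ (f : Fin m → Fin n) (x : Equiv.Perm (Fin n)),
    StrictMono f ∧
    (∀ j k : Fin m, w (f j) < w (f k) ↔ v j < v k) ∧
    (∀ i : Fin n, i ∉ Set.range f → x i = w i) ∧
    (∀ j k : Fin m, x (f j) < x (f k) ↔ u j < u k) ∧
    (∀ j : Fin m, ∃ k : Fin m, x (f j) = w (f k)) ∧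
    ∃ φ : {z : Equiv.Perm (Fin m) // BruhatLE u z ∧ BruhatLE z v} ≃
        {z : Equiv.Perm (Fin n) // BruhatLE x z ∧ BruhatLE z w},
      ∀ a b : {z : Equiv.Perm (Fin m) // BruhatLE u z ∧ BruhatLE z v},
        BruhatLE a.1 b.1 ↔ BruhatLE (φ a).1 (φ b).1

/-- The interval `[u,v]` belongs to family A:  for some `a, b ≥ 1` with `(a,b) ≠ (1,1)`,
`u = (a+1)a⋯1(a+b+2)(a+b+1)⋯(a+2)` and `v = (a+b+2)(a+1)a⋯2(a+b+1)(a+b)⋯(a+2)1`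
in `S_{a+b+2}`. -/
def InFamilyA {m : ℕ} (u v : Equiv.Perm (Fin m)) : Prop :=
  ∃ a b : ℕ, 1 ≤ a ∧ 1 ≤ b ∧ ¬(a = 1 ∧ b = 1) ∧ m = a + b + 2 ∧
    (∀ i, 1 ≤ i → i ≤ a + 1 → pval u i = a + 2 - i) ∧
    (∀ i, a + 2 ≤ i → i ≤ a + b + 2 → pval u i = 2 * a + b + 4 - i) ∧
    pval v 1 = a + b + 2 ∧
    (∀ i, 2 ≤ i → i ≤ a + 1 → pval v i = a + 3 - i) ∧
    (∀ i, a + 2 ≤ i → i ≤ a + b + 1 → pval v i = 2 * a + b + 3 - i) ∧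
    pval v (a + b + 2) = 1

/-- The interval `[u,v]` belongs to family B:  for some `a, b ≥ 0` with `a + b ≥ 1`,
`u = (a+1)a⋯1(a+3)(a+2)(a+b+4)(a+b+3)⋯(a+4)` and
`v = (a+3)(a+1)a⋯2(a+b+4)1(a+b+3)⋯(a+4)(a+2)` in `S_{a+b+4}`. -/
def InFamilyB {m : ℕ} (u v : Equiv.Perm (Fin m)) : Prop :=
  ∃ a b : ℕ, 1 ≤ a + b ∧ m = a + b + 4 ∧
    (∀ i, 1 ≤ i → i ≤ a + 1 → pval u i = a + 2 - i) ∧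
    pval u (a + 2) = a + 3 ∧ pval u (a + 3) = a + 2 ∧
    (∀ i, a + 4 ≤ i → i ≤ a + b + 4 → pval u i = 2 * a + b + 8 - i) ∧
    pval v 1 = a + 3 ∧
    (∀ i, 2 ≤ i → i ≤ a + 1 → pval v i = a + 3 - i) ∧
    pval v (a + 2) = a + b + 4 ∧ pval v (a + 3) = 1 ∧
    (∀ i, a + 4 ≤ i → i ≤ a + b + 3 → pval v i = 2 * a + b + 7 - i) ∧
    pval v (a + b + 4) = a + 2

theorem ell_lt_ell_mul_swap {m : ℕ} (a : Equiv.Perm (Fin m)) {i j : Fin m} (hij : i < j)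
    (h : a i < a j) : ell a < ell (a * Equiv.swap i j) := by
  classical
  unfold ell
  set t := Equiv.swap i j with ht
  have htt : ∀ k, t (t k) = k := fun k => Equiv.swap_apply_self i j k
  have hval : ∀ k, t k = if k = i then j else if k = j then i else k :=
    fun k => Equiv.swap_apply_def i j k
  let φ : Fin m × Fin m → Fin m × Fin m :=
    fun p => if t p.1 < t p.2 then (t p.1, t p.2) else p
  have hφφ : ∀ p : Fin m × Fin m, p.1 < p.2 → φ (φ p) = p := by
    intro p hp
    by_cases hc : t p.1 < t p.2
    · simp [φ, hc, htt, hp]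
    · simp [φ, hc]
  have hφij : φ (i, j) = (i, j) := by
    have h1 : t i = j := Equiv.swap_apply_left i j
    have h2 : t j = i := Equiv.swap_apply_right i j
    simp [φ, h1, h2, hij.le.not_gt]
  rw [← Finset.card_image_of_injOn (f := φ)]
  · apply Finset.card_lt_card
    rw [Finset.ssubset_iff]
    refine ⟨(i, j), ?_, ?_⟩
    · simp only [Finset.mem_image, Finset.mem_filter, Finset.mem_univ, true_and, not_exists,
        not_and]
      rintro p ⟨hp1, hp2⟩ hp
      have := hφφ p hp1
      rw [hp, hφij] at this
      subst this
      exact absurd hp2 (not_lt.mpr h.le)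
    · intro q hq
      rw [Finset.mem_insert] at hq
      rcases hq with rfl | hq
      · simp only [Finset.mem_filter, Finset.mem_univ, true_and]
        refine ⟨hij, ?_⟩
        simpa [t, Equiv.Perm.mul_apply] using h
      · obtain ⟨p, hp, rfl⟩ := Finset.mem_image.mp hq
        simp only [Finset.mem_filter, Finset.mem_univ, true_and] at hp ⊢
        obtain ⟨hp1, hp2⟩ := hp
        by_cases hc : t p.1 < t p.2
        · simp only [φ, hc, if_true, Equiv.Perm.mul_apply, htt]
          exact ⟨trivial, hp2⟩
        · simp only [φ, hc, if_false, Equiv.Perm.mul_apply]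
          refine ⟨hp1, ?_⟩
          have e1 := hval p.1
          have e2 := hval p.2
          grind
  · intro p hp q hq hpq
    simp only [Finset.coe_filter, Finset.mem_univ, true_and, Set.mem_ofPred_eq] at hp hq
    rw [← hφφ p hp.1, ← hφφ q hq.1, hpq]

theorem bruhat_step_iff {m : ℕ} (a b : Equiv.Perm (Fin m)) :
    (∃ i j : Fin m, i ≠ j ∧ b = a * Equiv.swap i j ∧ ell a < ell b) ↔
      ∃ i j : Fin m, i < j ∧ a i < a j ∧ b = a * Equiv.swap i j := by
  have key : ∀ i j : Fin m, i < j → ell a < ell (a * Equiv.swap i j) → a i < a j := by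
    intro i j hij hl
    by_contra hc
    have hne : a j ≠ a i := fun h => hij.ne' (a.injective h)
    have hlt : a j < a i := lt_of_le_of_ne (not_lt.mp hc) hne
    have := ell_lt_ell_mul_swap (a * Equiv.swap i j) hij (by simpa using hlt)
    rw [mul_assoc, Equiv.swap_mul_self, mul_one] at this
    omega
  constructor
  · rintro ⟨i, j, hij, rfl, hl⟩
    rcases lt_or_gt_of_ne hij with h | h
    · exact ⟨i, j, h, key i j h hl, rfl⟩
    · rw [Equiv.swap_comm] at hl
      exact ⟨j, i, h, key j i h hl, by rw [Equiv.swap_comm]⟩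
  · rintro ⟨i, j, hij, h, rfl⟩
    exact ⟨i, j, hij.ne, rfl, ell_lt_ell_mul_swap a hij h⟩

theorem BruhatLE.swap {m : ℕ} (a : Equiv.Perm (Fin m)) {i j : Fin m} (hij : i < j)
    (h : a i < a j) : BruhatLE a (a * Equiv.swap i j) :=
  Relation.ReflTransGen.single ((bruhat_step_iff _ _).mpr ⟨i, j, hij, h, rfl⟩)

/-- The number of positions below `P` at which `z` takes a value below `Q`. -/
def rankCount {n : ℕ} (z : Equiv.Perm (Fin n)) (P Q : ℕ) : ℕ :=
  (Finset.univ.filter fun i : Fin n => (i : ℕ) < P ∧ (z i : ℕ) < Q).card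

/-- The number of positions from `P` on at which `z` takes a value at least `Q`. -/
def corankCount {n : ℕ} (z : Equiv.Perm (Fin n)) (P Q : ℕ) : ℕ :=
  (Finset.univ.filter fun i : Fin n => P ≤ (i : ℕ) ∧ Q ≤ (z i : ℕ)).card

theorem BruhatLE.rankCount_le {n : ℕ} {a b : Equiv.Perm (Fin n)} (h : BruhatLE a b) (P Q : ℕ) :
    rankCount b P Q ≤ rankCount a P Q := by
  induction h with
  | refl => exact le_rfl
  | @tail c d _ hs ih =>
    refine le_trans ?_ ih
    obtain ⟨i, j, hij, hlt, rfl⟩ := (bruhat_step_iff _ _).mp hs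
    have hval := Equiv.swap_apply_def i j
    unfold rankCount
    by_cases hj : (j : ℕ) < P
    · refine Finset.card_le_card_of_injOn (Equiv.swap i j) ?_ (Equiv.injective _).injOn
      intro k hk
      obtain ⟨-, hk⟩ := Finset.mem_filter.mp (Finset.mem_coe.mp hk)
      refine Finset.mem_coe.mpr (Finset.mem_filter.mpr ⟨Finset.mem_univ _, ?_, hk.2⟩)
      have := hval k
      grind
    · refine Finset.card_le_card ?_
      intro k hk
      simp only [Finset.mem_filter, Finset.mem_univ, true_and, Equiv.Perm.mul_apply] at hk ⊢
      have := hval k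
      grind

theorem rankCount_add {n : ℕ} (y z : Equiv.Perm (Fin n)) (P Q : ℕ) :
    rankCount y P Q + corankCount z P Q = rankCount z P Q + corankCount y P Q := by
  have key : ∀ z : Equiv.Perm (Fin n),
      rankCount z P Q + (Finset.univ.filter fun i : Fin n => Q ≤ (i : ℕ)).card =
        corankCount z P Q + (Finset.univ.filter fun i : Fin n => (i : ℕ) < P).card := by
    intro z
    have h1 : (Finset.univ.filter fun i : Fin n => Q ≤ (i : ℕ)).card =
        (Finset.univ.filter fun i : Fin n => Q ≤ (z i : ℕ)).card := by
      symm
      refine Finset.card_bij (fun i _ => z i) ?_ (fun _ _ _ _ h => z.injective h) ?_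
      · simp
      · intro b hb
        exact ⟨z.symm b, by simpa using hb, by simp⟩
    rw [h1, rankCount, corankCount,
      ← Finset.card_filter_add_card_filter_not (s := Finset.univ.filter fun i : Fin n => Q ≤ (z i : ℕ))
        (fun i => (i : ℕ) < P),
      ← Finset.card_filter_add_card_filter_not (s := Finset.univ.filter fun i : Fin n => (i : ℕ) < P)
        (fun i => (z i : ℕ) < Q)]
    simp only [Finset.filter_filter, not_lt]
    rw [Finset.filter_congr (p := fun i : Fin n => Q ≤ (z i : ℕ) ∧ (i : ℕ) < P)
        (q := fun i : Fin n => (i : ℕ) < P ∧ Q ≤ (z i : ℕ)) (fun i _ => and_comm),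
      Finset.filter_congr (p := fun i : Fin n => Q ≤ (z i : ℕ) ∧ P ≤ (i : ℕ))
        (q := fun i : Fin n => P ≤ (i : ℕ) ∧ Q ≤ (z i : ℕ)) (fun i _ => and_comm)]
    omega
  have h1 := key y
  have h2 := key z
  omega

theorem rankCount_succ {n : ℕ} (z : Equiv.Perm (Fin n)) (p : Fin n) (Q : ℕ) :
    rankCount z (p + 1) Q = rankCount z p Q + if (z p : ℕ) < Q then 1 else 0 := by
  unfold rankCount
  split_ifs with h
  · rw [← Finset.card_insert_of_notMem (a := p) (by simp)]
    congr 1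
    ext i
    simp only [Finset.mem_filter, Finset.mem_univ, true_and, Finset.mem_insert]
    grind
  · rw [add_zero]
    congr 1
    ext i
    simp only [Finset.mem_filter, Finset.mem_univ, true_and]
    grind

/-- If `x ≤ y ≤ w` and the ranks of `x` and `w` agree around the point `(p, w p)`, then `y`
passes through that point. -/
theorem apply_eq_of_rankCount_eq {n : ℕ} {x y w : Equiv.Perm (Fin n)} (hxy : BruhatLE x y)
    (hyw : BruhatLE y w) (p : Fin n)
    (h : ∀ P Q : ℕ, (P = p ∨ P = p + 1) → (Q = w p ∨ Q = w p + 1) →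
      rankCount x P Q = rankCount w P Q) : y p = w p := by
  have hy : ∀ P Q : ℕ, (P = p ∨ P = p + 1) → (Q = w p ∨ Q = w p + 1) →
      rankCount y P Q = rankCount w P Q := by
    intro P Q hP hQ
    have h1 := hxy.rankCount_le P Q
    have h2 := hyw.rankCount_le P Q
    have h3 := h P Q hP hQ
    omega
  have a1 := rankCount_succ y p (w p)
  have a2 := rankCount_succ y p (w p + 1)
  have b1 := rankCount_succ w p (w p)
  have b2 := rankCount_succ w p (w p + 1)
  rw [hy _ _ (by simp) (by simp), hy _ _ (by simp) (by simp)] at a1 a2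
  apply Fin.ext
  grind

/-- The permutation obtained from `w` by rearranging the values at the positions in the range of
`f`, where `w` has the relative order of `v`, into the relative order of `z`. -/
noncomputable def rearrange {m n : ℕ} (f : Fin m ↪ Fin n) (w : Equiv.Perm (Fin n))
    (v z : Equiv.Perm (Fin m)) : Equiv.Perm (Fin n) :=
  w * (v⁻¹ * z).viaEmbedding f

section rearrange

variable {m n : ℕ} (f : Fin m ↪ Fin n) (w : Equiv.Perm (Fin n)) (v : Equiv.Perm (Fin m))

theorem rearrange_apply (z : Equiv.Perm (Fin m)) (j : Fin m) :
    rearrange f w v z (f j) = w (f (v⁻¹ (z j))) := by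
  simp [rearrange, Equiv.Perm.viaEmbedding_apply]

theorem rearrange_apply_of_notMem (z : Equiv.Perm (Fin m)) {p : Fin n} (hp : p ∉ Set.range f) :
    rearrange f w v z p = w p := by
  simp [rearrange, Equiv.Perm.viaEmbedding_apply_of_notMem _ _ _ hp]

theorem rearrange_self : rearrange f w v v = w := by
  rw [rearrange, inv_mul_cancel, ← Equiv.Perm.viaEmbeddingHom_apply, map_one, mul_one]

theorem rearrange_injective : Function.Injective (rearrange f w v) := by
  intro a b h
  have h1 := mul_left_cancel h
  rw [← Equiv.Perm.viaEmbeddingHom_apply, ← Equiv.Perm.viaEmbeddingHom_apply] at h1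
  exact mul_left_cancel (Equiv.Perm.viaEmbeddingHom_injective f h1)

theorem rearrange_mul_swap (z : Equiv.Perm (Fin m)) (i j : Fin m) :
    rearrange f w v (z * Equiv.swap i j) =
      rearrange f w v z * Equiv.swap (f i) (f j) := by
  ext p
  congr 1
  by_cases hp : p ∈ Set.range f
  · obtain ⟨k, rfl⟩ := hp
    rw [Equiv.Perm.mul_apply, ← f.injective.map_swap, rearrange_apply, rearrange_apply,
      Equiv.Perm.mul_apply]
  · rw [Equiv.Perm.mul_apply, Equiv.swap_apply_of_ne_of_ne, rearrange_apply_of_notMem _ _ _ _ hp,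
      rearrange_apply_of_notMem _ _ _ _ hp]
    · rintro rfl
      exact hp ⟨i, rfl⟩
    · rintro rfl
      exact hp ⟨j, rfl⟩

variable {f w v}

theorem rearrange_lt_iff (hw : ∀ j k, w (f j) < w (f k) ↔ v j < v k) (z : Equiv.Perm (Fin m))
    (j k : Fin m) : rearrange f w v z (f j) < rearrange f w v z (f k) ↔ z j < z k := by
  simp [rearrange_apply, hw]

theorem rearrange_bruhatLE (hf : StrictMono f) (hw : ∀ j k, w (f j) < w (f k) ↔ v j < v k)
    {a b : Equiv.Perm (Fin m)} (h : BruhatLE a b) :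
    BruhatLE (rearrange f w v a) (rearrange f w v b) := by
  induction h with
  | refl => exact Relation.ReflTransGen.refl
  | tail _ hs ih =>
    obtain ⟨i, j, hij, hlt, rfl⟩ := (bruhat_step_iff _ _).mp hs
    refine ih.trans ?_
    rw [rearrange_mul_swap]
    exact BruhatLE.swap _ (hf hij) ((rearrange_lt_iff hw _ _ _).mpr hlt)

theorem exists_rearrange_of_bruhatLE (hf : StrictMono f)
    (hw : ∀ j k, w (f j) < w (f k) ↔ v j < v k) {x : Equiv.Perm (Fin n)}
    (hfix : ∀ y, BruhatLE x y → BruhatLE y w → ∀ p, p ∉ Set.range f → y p = w p)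
    (a : Equiv.Perm (Fin m)) (hxa : BruhatLE x (rearrange f w v a)) {y : Equiv.Perm (Fin n)}
    (hay : BruhatLE (rearrange f w v a) y) (hyw : BruhatLE y w) :
    ∃ b, y = rearrange f w v b ∧ BruhatLE a b := by
  induction hay with
  | refl => exact ⟨a, rfl, Relation.ReflTransGen.refl⟩
  | @tail c d hc hs ih =>
    have hcd : BruhatLE c d := Relation.ReflTransGen.single hs
    obtain ⟨b, rfl, hab⟩ := ih (hcd.trans hyw)
    have hd : ∀ p, p ∉ Set.range f → d p = w p := hfix d (hxa.trans (hc.tail hs)) hyw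
    obtain ⟨i, j, hij, hlt, rfl⟩ := (bruhat_step_iff _ _).mp hs
    have hi : i ∈ Set.range f := by
      by_contra hi
      have h1 := hd i hi
      rw [← rearrange_apply_of_notMem f w v b hi, Equiv.Perm.mul_apply,
        Equiv.swap_apply_left] at h1
      exact hlt.ne h1.symm
    have hj : j ∈ Set.range f := by
      by_contra hj
      have h1 := hd j hj
      rw [← rearrange_apply_of_notMem f w v b hj, Equiv.Perm.mul_apply,
        Equiv.swap_apply_right] at h1
      exact hlt.ne h1
    obtain ⟨i, rfl⟩ := hi
    obtain ⟨j, rfl⟩ := hj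
    refine ⟨b * Equiv.swap i j, (rearrange_mul_swap _ _ _ _ _ _).symm, hab.trans ?_⟩
    exact BruhatLE.swap _ (hf.lt_iff_lt.mp hij) ((rearrange_lt_iff hw _ _ _).mp hlt)

theorem IntervalEmbeds.of_fixed {u : Equiv.Perm (Fin m)} (huv : BruhatLE u v)
    (hf : StrictMono f) (hw : ∀ j k, w (f j) < w (f k) ↔ v j < v k)
    (hfix : ∀ y, BruhatLE (rearrange f w v u) y → BruhatLE y w →
      ∀ p, p ∉ Set.range f → y p = w p) : IntervalEmbeds u v w := by
  have hmono : ∀ {a b}, BruhatLE a b → BruhatLE (rearrange f w v a) (rearrange f w v b) :=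
    fun h => rearrange_bruhatLE hf hw h
  have htop : ∀ {b}, BruhatLE b v → BruhatLE (rearrange f w v b) w := fun h => by
    have h1 := hmono h
    rwa [rearrange_self] at h1
  have hlift := fun a ha y => exists_rearrange_of_bruhatLE hf hw hfix a ha (y := y)
  have hrefl : ∀ {a b : Equiv.Perm (Fin m)}, BruhatLE u a → BruhatLE b v →
      BruhatLE (rearrange f w v a) (rearrange f w v b) → BruhatLE a b := by
    intro a b ha hb hab
    obtain ⟨c, hc, hac⟩ := hlift a (hmono ha) _ hab (htop hb)
    rwa [rearrange_injective f w v hc]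
  refine ⟨huv, f, rearrange f w v u, hf, hw,
    fun p hp => rearrange_apply_of_notMem _ _ _ _ hp, rearrange_lt_iff hw u,
    fun j => ⟨_, rearrange_apply _ _ _ _ _⟩, Equiv.ofBijective
      (fun z => ⟨rearrange f w v z.1, hmono z.2.1, htop z.2.2⟩) ⟨?_, ?_⟩, ?_⟩
  · intro a b h
    exact Subtype.ext (rearrange_injective f w v (congrArg Subtype.val h))
  · rintro ⟨y, hxy, hyw⟩
    obtain ⟨z, rfl, huz⟩ := hlift u Relation.ReflTransGen.refl _ hxy hyw
    obtain ⟨v', hv', hzv⟩ := hlift z hxy _ hyw Relation.ReflTransGen.refl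
    obtain rfl := rearrange_injective f w v ((rearrange_self f w v).trans hv')
    exact ⟨⟨z, huz, hzv⟩, rfl⟩
  · intro a b
    exact ⟨fun h => hmono h, fun h => hrefl a.2.1 b.2.2 h⟩

/-- An interval pattern embeds at the positions `f` as soon as every other point of `w` either
lies outside the rectangle spanned by the pattern, or is southwest of a point of the pattern
having only larger values to its left, or northeast of a point of the pattern having only
smaller values to its right. -/
theorem IntervalEmbeds.of_points {u : Equiv.Perm (Fin m)} (huv : BruhatLE u v)
    (hf : StrictMono f) (hw : ∀ j k, w (f j) < w (f k) ↔ v j < v k)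
    (hpt : ∀ p, p ∉ Set.range f →
      ((∀ j, p < f j) ∨ (∀ j, f j < p) ∨ (∀ j, w p < w (f j)) ∨ (∀ j, w (f j) < w p)) ∨
      (∃ k, (∀ j < k, v k ≤ v j ∧ v k ≤ u j) ∧ p < f k ∧ w p < w (f k)) ∨
      (∃ k, (∀ j, k < j → v j ≤ v k ∧ u j ≤ v k) ∧ f k < p ∧ w (f k) < w p)) :
    IntervalEmbeds u v w := by
  have hle : ∀ j k, v j ≤ v k → w (f j) ≤ w (f k) := by
    intro j k h
    by_contra hc
    exact absurd ((hw _ _).mp (not_le.mp hc)) (not_lt.mpr h)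
  refine IntervalEmbeds.of_fixed huv hf hw fun y hxy hyw p hp => ?_
  refine apply_eq_of_rankCount_eq hxy hyw p fun P Q hP hQ => ?_
  have hoff : ∀ i, i ∉ Set.range f → rearrange f w v u i = w i :=
    fun i hi => rearrange_apply_of_notMem _ _ _ _ hi
  have hne : ∀ j, f j ≠ p := fun j h => hp ⟨j, h⟩
  have hnw : ∀ j, w (f j) ≠ w p := fun j h => hne j (w.injective h)
  have hx := rearrange_apply f w v u
  have hcase : (∀ j, f j < p → w p < w (f j) ∧ w p < rearrange f w v u (f j)) ∨
      (∀ j, p < f j → w (f j) < w p ∧ rearrange f w v u (f j) < w p) := by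
    rcases hpt p hp with (h | h | h | h) | ⟨k, hk, h1, h2⟩ | ⟨k, hk, h1, h2⟩
    · exact Or.inl fun j hj => absurd (h j) hj.not_gt
    · exact Or.inr fun j hj => absurd (h j) hj.not_gt
    · exact Or.inl fun j _ => ⟨h j, by rw [hx]; exact h _⟩
    · exact Or.inr fun j _ => ⟨h j, by rw [hx]; exact h _⟩
    · refine Or.inl fun j hj => ?_
      obtain ⟨h3, h4⟩ := hk j (hf.lt_iff_lt.mp (hj.trans h1))
      refine ⟨h2.trans_le (hle _ _ h3), ?_⟩
      rw [hx]
      exact h2.trans_le (hle _ _ (by simpa using h4))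
    · refine Or.inr fun j hj => ?_
      obtain ⟨h3, h4⟩ := hk j (hf.lt_iff_lt.mp (h1.trans hj))
      refine ⟨(hle _ _ h3).trans_lt h2, ?_⟩
      rw [hx]
      exact (hle _ _ (by simpa using h4)).trans_lt h2
  rcases hcase with h | h
  · unfold rankCount
    congr 1
    refine Finset.filter_congr fun i _ => ?_
    by_cases hi : i ∈ Set.range f
    · obtain ⟨j, rfl⟩ := hi
      have h1 := h j
      have h2 := hne j
      grind
    · rw [hoff i hi]
  · have : corankCount (rearrange f w v u) P Q = corankCount w P Q := by
      unfold corankCount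
      congr 1
      refine Finset.filter_congr fun i _ => ?_
      by_cases hi : i ∈ Set.range f
      · obtain ⟨j, rfl⟩ := hi
        have h1 := h j
        have h2 := hne j
        grind
      · rw [hoff i hi]
    have := rankCount_add (rearrange f w v u) w P Q
    omega

end rearrange

section ConjugateOrders

variable {α : Type*} {lt tri : α → α → Prop}

/-- Two strict orders, each the conjugate of the other, such that the elements on a fixed side
of any given element for the second order are comparable to at most one another for the first. -/
structure SparseConjugate (lt tri : α → α → Prop) : Prop where
  lt_trans : ∀ a b c, lt a b → lt b c → lt a c
  lt_irrefl : ∀ a, ¬ lt a a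
  tri_trans : ∀ a b c, tri a b → tri b c → tri a c
  tri_irrefl : ∀ a, ¬ tri a a
  total : ∀ a b, a = b ∨ lt a b ∨ lt b a ∨ tri a b ∨ tri b a
  disjoint : ∀ a b, lt a b → ¬ tri a b ∧ ¬ tri b a
  sparse_right : ∀ e x y z, tri e x → tri e y → tri e z → y ≠ z →
    (lt x y ∨ lt y x) → (lt x z ∨ lt z x) → False
  sparse_left : ∀ e x y z, tri x e → tri y e → tri z e → y ≠ z →
    (lt x y ∨ lt y x) → (lt x z ∨ lt z x) → False

theorem SparseConjugate.flip_lt (h : SparseConjugate lt tri) : SparseConjugate (flip lt) tri where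
  lt_trans a b c hab hbc := h.lt_trans c b a hbc hab
  lt_irrefl := h.lt_irrefl
  tri_trans := h.tri_trans
  tri_irrefl := h.tri_irrefl
  total a b := by
    have := h.total a b
    simp only [flip]
    tauto
  disjoint a b hab := (h.disjoint b a hab).symm
  sparse_right e x y z h1 h2 h3 h4 h5 h6 := h.sparse_right e x y z h1 h2 h3 h4 h5.symm h6.symm
  sparse_left e x y z h1 h2 h3 h4 h5 h6 := h.sparse_left e x y z h1 h2 h3 h4 h5.symm h6.symm

theorem SparseConjugate.flip_tri (h : SparseConjugate lt tri) :
    SparseConjugate lt (flip tri) where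
  lt_trans := h.lt_trans
  lt_irrefl := h.lt_irrefl
  tri_trans a b c hab hbc := h.tri_trans c b a hbc hab
  tri_irrefl := h.tri_irrefl
  total a b := by
    have := h.total a b
    simp only [flip]
    tauto
  disjoint a b hab := (h.disjoint a b hab).symm
  sparse_right := h.sparse_left
  sparse_left := h.sparse_right

theorem exists_maximal_above [Finite α] (htrans : ∀ a b c, lt a b → lt b c → lt a c)
    (hirrefl : ∀ a, ¬ lt a a) (P : α → Prop) (a : α) (ha : P a) :
    ∃ m, P m ∧ (m = a ∨ lt a m) ∧ ∀ q, P q → ¬ lt m q := by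
  have : IsTrans α (flip lt) := ⟨fun a b c hab hbc => htrans c b a hbc hab⟩
  have : Std.Irrefl (flip lt) := ⟨hirrefl⟩
  obtain ⟨m, ⟨hm, ham⟩, hmax⟩ := (Finite.wellFounded_of_trans_of_irrefl (flip lt)).has_min
    {m | P m ∧ (m = a ∨ lt a m)} ⟨a, ha, Or.inl rfl⟩
  refine ⟨m, hm, ham, fun q hq hmq => hmax q ⟨hq, Or.inr ?_⟩ hmq⟩
  rcases ham with rfl | ham
  · exact hmq
  · exact htrans _ _ _ ham hmq

/-- The order `lt` is the union of a lower set and an upper set meeting in one of three ways. -/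
def Splits (lt : α → α → Prop) : Prop :=
  (∃ C D : Finset α, C.Nonempty ∧ D.Nonempty ∧ ¬ (C.card = 1 ∧ D.card = 1) ∧
    (∀ c ∈ C, ∀ c' ∈ C, ¬ lt c c') ∧ (∀ d ∈ D, ∀ d' ∈ D, ¬ lt d d') ∧
    (∀ c ∈ C, ∀ d ∈ D, lt c d) ∧
    ∀ p, p ∈ C ∨ p ∈ D ∨ (∃ c ∈ C, lt p c) ∨ ∃ d ∈ D, lt d p) ∨
  (∃ c m d, lt c m ∧ lt m d ∧ ∀ p, p = c ∨ p = m ∨ p = d ∨ lt p c ∨ lt d p) ∨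
  (∃ c c' d d', lt c d ∧ lt c' d ∧ lt c d' ∧ c ≠ c' ∧ d ≠ d' ∧ ¬ lt c c' ∧ ¬ lt c' c ∧
    ¬ lt d d' ∧ ¬ lt d' d ∧ ¬ lt c' d' ∧ ¬ lt d' c' ∧
    ∀ p, p = c ∨ p = c' ∨ p = d ∨ p = d' ∨ lt p c ∨ lt p c' ∨ lt d p ∨ lt d' p)

theorem Splits.of_flip (h : Splits (flip lt)) : Splits lt := by
  simp only [Splits, flip] at h
  rcases h with ⟨C, D, hC, hD, hcard, h1, h2, h3, h4⟩ | ⟨c, m, d, h1, h2, h3⟩ |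
    ⟨c, c', d, d', h1, h2, h3, h4, h5, h6, h7, h8, h9, h10, h11, h12⟩
  · refine Or.inl ⟨D, C, hD, hC, fun h => hcard h.symm, fun a ha b hb => h2 b hb a ha,
      fun a ha b hb => h1 b hb a ha, fun a ha b hb => h3 b hb a ha, fun p => ?_⟩
    rcases h4 p with h | h | h | h <;> simp [h]
  · refine Or.inr (Or.inl ⟨d, m, c, h2, h1, fun p => ?_⟩)
    have := h3 p
    tauto
  · refine Or.inr (Or.inr ⟨d, d', c, c', h1, h3, h2, h5, h4, h9, h8, h7, h6, h10, h11,
      fun p => ?_⟩)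
    have := h12 p
    tauto

/-- A covering pair such that every element lies below its top or above its bottom. -/
def HasSpanningCover (lt : α → α → Prop) : Prop :=
  ∃ c d, lt c d ∧ (∀ p, ¬ (lt c p ∧ lt p d)) ∧ ∀ p, lt p d ∨ lt c p

theorem HasSpanningCover.of_flip (h : HasSpanningCover (flip lt)) :
    HasSpanningCover lt := by
  obtain ⟨c, d, h1, h2, h3⟩ := h
  exact ⟨d, c, h1, fun p hp => h2 p hp.symm, fun p => (h3 p).symm⟩

namespace SparseConjugate

theorem spans_of_fork_of_tri (h : SparseConjugate lt tri) {x y z : α} (hy : lt y x) (hz : lt z x)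
    (hyz : tri y z) : (∀ p, lt p x ∨ lt y p) ∨ (∀ p, lt p x ∨ lt z p) := by
  by_contra! hc
  obtain ⟨⟨e, he, he'⟩, f, hf, hf'⟩ := hc
  obtain ⟨lt_trans, lt_irrefl, tri_trans, tri_irrefl, total, disj, sr, sl⟩ := h
  have hey := total e y
  have hex := total e x
  have hez := total e z
  have hfy := total f y
  have hfx := total f x
  have hfz := total f z
  have hne : y ≠ z := fun h => tri_irrefl y (by rw [← h] at hyz; exact hyz)
  have e1 : tri y e := by grind
  have e2 : tri x e := by grind
  have f1 : tri f z := by grind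
  have f2 : tri f x := by grind
  have e3 : lt z e := by grind
  have f3 : lt y f := by grind
  grind

theorem spans_of_fork (h : SparseConjugate lt tri) {x y z : α} (hy : lt y x) (hz : lt z x)
    (hne : y ≠ z) (h1 : ¬ lt y z) (h2 : ¬ lt z y) :
    (∀ p, lt p x ∨ lt y p) ∨ (∀ p, lt p x ∨ lt z p) := by
  rcases h.total y z with h3 | h3 | h3 | h3 | h3
  · exact absurd h3 hne
  · exact absurd h3 h1
  · exact absurd h3 h2
  · exact h.spans_of_fork_of_tri hy hz h3
  · exact h.flip_tri.spans_of_fork_of_tri hy hz h3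

theorem hasSpanningCover_of_fork [Finite α] (h : SparseConjugate lt tri) {x y z : α} (hy : lt y x)
    (hz : lt z x) (hne : y ≠ z) (h1 : ¬ lt y z) (h2 : ¬ lt z y) : HasSpanningCover lt := by
  obtain ⟨x, ⟨y, z, hy, hz, hne, h1, h2⟩, -, hx⟩ := exists_maximal_above h.flip_lt.lt_trans
    h.flip_lt.lt_irrefl (fun x => ∃ y z, lt y x ∧ lt z x ∧ y ≠ z ∧ ¬ lt y z ∧ ¬ lt z y) x
    ⟨y, z, hy, hz, hne, h1, h2⟩
  obtain ⟨y', hy', hyy', hymax⟩ :=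
    exists_maximal_above h.lt_trans h.lt_irrefl (fun p => lt p x) y hy
  obtain ⟨z', hz', hzz', hzmax⟩ :=
    exists_maximal_above h.lt_trans h.lt_irrefl (fun p => lt p x) z hz
  have hne' : y' ≠ z' := by
    rintro rfl
    have hyy : lt y y' := by grind
    have hzz : lt z y' := by grind
    exact hx y' ⟨y, z, hyy, hzz, hne, h1, h2⟩ hy'
  rcases h.spans_of_fork hy' hz' hne' (hymax _ hz') (hzmax _ hy') with h3 | h3
  · exact ⟨y', x, hy', fun p hp => hymax p hp.2 hp.1, h3⟩
  · exact ⟨z', x, hz', fun p hp => hzmax p hp.2 hp.1, h3⟩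

theorem hasSpanningCover_of_chain [Finite α] (h : SparseConjugate lt tri) {x y z : α}
    (hxy : lt x y) (hyz : lt y z) : HasSpanningCover lt := by
  by_contra hno
  have hlow : ∀ x y z, lt y x → lt z x → y = z ∨ lt y z ∨ lt z y := by
    intro x y z hy hz
    by_contra! hc
    exact hno (h.hasSpanningCover_of_fork hy hz hc.1 hc.2.1 hc.2.2)
  obtain ⟨c, hc, -, hmax⟩ := exists_maximal_above h.lt_trans h.lt_irrefl (fun p => lt p y) x hxy
  refine hno ⟨c, y, hc, fun p hp => hmax p hp.2 hp.1, fun p => ?_⟩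
  by_contra! hp
  obtain ⟨lt_trans, lt_irrefl, tri_trans, tri_irrefl, total, disj, sr, sl⟩ := h
  have h1 := total p c
  have h2 := total p y
  have h3 := total p z
  have h4 := hlow z p y
  have hcz := lt_trans _ _ _ hc hyz
  have hne : c ≠ z := by rintro rfl; exact lt_irrefl _ hcz
  rcases h3 with rfl | h3 | h3 | h3 | h3
  · grind
  · grind
  · grind
  · have : tri p y := by grind
    have : tri p c := by grind
    exact sr p y c z ‹_› ‹_› ‹_› hne (Or.inr hc) (Or.inl hyz)
  · have : tri y p := by grind
    have : tri c p := by grind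
    exact sl p y c z ‹_› ‹_› ‹_› hne (Or.inr hc) (Or.inl hyz)

theorem hasSpanningCover [Finite α] (h : SparseConjugate lt tri) {x y z : α} (hne : y ≠ z)
    (hxy : lt x y ∨ lt y x) (hxz : lt x z ∨ lt z x) : HasSpanningCover lt := by
  by_cases h1 : lt y z ∨ lt z y
  · have key : ∀ a b c, lt a b → lt b c → HasSpanningCover lt :=
      fun a b c => h.hasSpanningCover_of_chain
    have := h.lt_irrefl
    grind
  · rw [not_or] at h1
    rcases hxy with hxy | hxy <;> rcases hxz with hxz | hxz
    · exact HasSpanningCover.of_flip (h.flip_lt.hasSpanningCover_of_fork hxy hxz hne h1.2 h1.1)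
    · exact h.hasSpanningCover_of_chain hxz hxy
    · exact h.hasSpanningCover_of_chain hxy hxz
    · exact h.hasSpanningCover_of_fork hxy hxz hne h1.1 h1.2

/-- In a non-complete split along a spanning cover `c < d`, with `c'` a maximal element below `d`
and `d'` a minimal element above `c`, there is no third maximal element below `d`. -/
theorem eq_or_eq_of_not_lt (h : SparseConjugate lt tri) {c c' c'' d d' : α} (hcd : lt c d)
    (hc'd : lt c' d) (hcd' : lt c d') (hc''d : lt c'' d) (hmax : ∀ p, lt p d → ¬ lt c' p)
    (hmax'' : ∀ p, lt p d → ¬ lt c'' p) (hmaxc : ∀ p, lt p d → ¬ lt c p)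
    (hmin : ∀ p, lt c p → ¬ lt p d') (hno : ¬ lt c' d') :
    c'' = c ∨ c'' = c' := by
  by_contra! hne
  obtain ⟨lt_trans, lt_irrefl, tri_trans, tri_irrefl, total, disj, sr, sl⟩ := h
  have h1 := total c' d'
  have h2 := total c c'
  have h3 := total d d'
  have h4 := total c c''
  have h5 := total c' c''
  have h6 := total c'' d'
  have n1 : c' ≠ d' := by grind
  have n2 : ¬ lt d' c' := by grind
  have n3 : c ≠ c' := by grind
  have n4 : d ≠ d' := by grind
  rcases h1 with h1 | h1 | h1 | h1 | h1
  · grind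
  · grind
  · grind
  · have k1 : tri d d' := by grind
    have k2 : tri c' c := by grind
    have k3 : ¬ tri c'' d' := fun hh => sl d' d c' c'' k1 h1 hh (Ne.symm hne.2) (Or.inr hc'd)
      (Or.inr hc''d)
    have k4 : lt c'' d' := by grind
    have k5 : tri c'' c' := by grind
    grind
  · have k1 : tri d' d := by grind
    have k2 : tri c c' := by grind
    have k3 : ¬ tri d' c'' := fun hh => sr d' d c' c'' k1 h1 hh (Ne.symm hne.2) (Or.inr hc'd)
      (Or.inr hc''d)
    have k4 : lt c'' d' := by grind
    have k5 : tri c' c'' := by grind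
    grind

theorem splits_of_above [Fintype α] (h : SparseConjugate lt tri) {c d e : α} (hcd : lt c d)
    (hcov : ∀ p, p = c ∨ lt p c ∨ p = d ∨ lt d p) (he : lt d e) : Splits lt := by
  classical
  have hmin := fun e => exists_maximal_above h.flip_lt.lt_trans h.flip_lt.lt_irrefl
    (fun p => lt d p) e
  obtain ⟨m, hm, -, hmmin⟩ := hmin e he
  by_cases hall : ∀ q, lt d q → q = m ∨ lt m q
  · refine Or.inr (Or.inl ⟨c, d, m, hcd, hm, fun p => ?_⟩)
    have h1 := hcov p
    have h2 := hall p
    tauto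
  · push Not at hall
    obtain ⟨q, hq, hqm, hmq⟩ := hall
    obtain ⟨q', hq', hqq', hqmin⟩ := hmin q hq
    refine Or.inl ⟨{d}, Finset.univ.filter fun p => lt d p ∧ ∀ r, lt d r → ¬ flip lt p r,
      ⟨d, by simp⟩, ⟨m, by simpa using ⟨hm, hmmin⟩⟩, ?_, ?_, ?_, ?_, ?_⟩
    · rintro ⟨-, h1⟩
      obtain ⟨s, hs⟩ := Finset.card_eq_one.mp h1
      have hms : m ∈ ({s} : Finset α) := by
        rw [← hs]
        simpa using ⟨hm, hmmin⟩
      have hqs : q' ∈ ({s} : Finset α) := by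
        rw [← hs]
        simpa using ⟨hq', hqmin⟩
      rw [Finset.mem_singleton] at hms hqs
      rw [hqs, ← hms] at hqq'
      rcases hqq' with h2 | h2
      · exact hqm h2.symm
      · exact hmq h2
    · simp [h.lt_irrefl]
    · intro a ha b hb
      simp only [Finset.mem_filter, Finset.mem_univ, true_and] at ha hb
      exact hb.2 a ha.1
    · intro a ha b hb
      simp only [Finset.mem_filter, Finset.mem_univ, true_and, Finset.mem_singleton] at ha hb
      rw [ha]
      exact hb.1
    · intro p
      simp only [Finset.mem_filter, Finset.mem_univ, true_and, Finset.mem_singleton,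
        exists_eq_left]
      rcases hcov p with rfl | h1 | h1 | h1
      · exact Or.inr (Or.inr (Or.inl hcd))
      · exact Or.inr (Or.inr (Or.inl (h.lt_trans _ _ _ h1 hcd)))
      · exact Or.inl h1
      · obtain ⟨r, hr, hpr, hrmin⟩ := hmin p h1
        rcases hpr with rfl | hpr
        · exact Or.inr (Or.inl ⟨hr, hrmin⟩)
        · exact Or.inr (Or.inr (Or.inr ⟨r, ⟨hr, hrmin⟩, hpr⟩))

theorem splits_of_hasSpanningCover [Fintype α] (h : SparseConjugate lt tri)
    (hcover : HasSpanningCover lt) (hthree : ∀ a b : α, ∃ e, e ≠ a ∧ e ≠ b) : Splits lt := by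
  classical
  obtain ⟨c, d, hcd, hno, hspan⟩ := hcover
  have hmax := exists_maximal_above h.lt_trans h.lt_irrefl fun p => lt p d
  have hmin := exists_maximal_above h.flip_lt.lt_trans h.flip_lt.lt_irrefl fun p => lt c p
  obtain ⟨C, hC⟩ : ∃ C : Finset α, ∀ p, p ∈ C ↔ lt p d ∧ ∀ q, lt q d → ¬ lt p q :=
    ⟨Finset.univ.filter fun p => lt p d ∧ ∀ q, lt q d → ¬ lt p q, by simp⟩
  obtain ⟨D, hD⟩ : ∃ D : Finset α, ∀ p, p ∈ D ↔ lt c p ∧ ∀ q, lt c q → ¬ lt q p :=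
    ⟨Finset.univ.filter fun p => lt c p ∧ ∀ q, lt c q → ¬ lt q p, by simp⟩
  have hcC : c ∈ C := (hC c).mpr ⟨hcd, fun q h1 h2 => hno q ⟨h2, h1⟩⟩
  have hdD : d ∈ D := (hD d).mpr ⟨hcd, fun q h1 h2 => hno q ⟨h1, h2⟩⟩
  have hcov : ∀ p, p ∈ C ∨ p ∈ D ∨ (∃ c ∈ C, lt p c) ∨ ∃ d ∈ D, lt d p := by
    intro p
    rcases hspan p with h1 | h1
    · obtain ⟨r, hr, rfl | hpr, hrmax⟩ := hmax p h1
      · exact Or.inl ((hC r).mpr ⟨hr, hrmax⟩)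
      · exact Or.inr (Or.inr (Or.inl ⟨r, (hC r).mpr ⟨hr, hrmax⟩, hpr⟩))
    · obtain ⟨r, hr, rfl | hpr, hrmin⟩ := hmin p h1
      · exact Or.inr (Or.inl ((hD r).mpr ⟨hr, hrmin⟩))
      · exact Or.inr (Or.inr (Or.inr ⟨r, (hD r).mpr ⟨hr, hrmin⟩, hpr⟩))
  by_cases hcard : C.card = 1 ∧ D.card = 1
  · have hC1 : ∀ p, p ∈ C ↔ p = c := by
      obtain ⟨s, hs⟩ := Finset.card_eq_one.mp hcard.1
      rw [hs, Finset.mem_singleton] at hcC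
      intro p
      rw [hs, Finset.mem_singleton, hcC]
    have hD1 : ∀ p, p ∈ D ↔ p = d := by
      obtain ⟨s, hs⟩ := Finset.card_eq_one.mp hcard.2
      rw [hs, Finset.mem_singleton] at hdD
      intro p
      rw [hs, Finset.mem_singleton, hdD]
    simp only [hC1, hD1, exists_eq_left] at hcov
    obtain ⟨e, hec, hed⟩ := hthree c d
    rcases hcov e with h1 | h1 | h1 | h1
    · exact absurd h1 hec
    · exact absurd h1 hed
    · refine Splits.of_flip (h.flip_lt.splits_of_above (c := d) (d := c) hcd (fun p => ?_) h1)
      have := hcov p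
      simp only [flip]
      tauto
    · refine h.splits_of_above hcd (fun p => ?_) h1
      have := hcov p
      tauto
  by_cases hcomp : ∀ c ∈ C, ∀ d ∈ D, lt c d
  · exact Or.inl ⟨C, D, ⟨c, hcC⟩, ⟨d, hdD⟩, hcard,
      fun a ha b hb => ((hC a).mp ha).2 b ((hC b).mp hb).1,
      fun a ha b hb => ((hD b).mp hb).2 a ((hD a).mp ha).1, hcomp, hcov⟩
  · push Not at hcomp
    obtain ⟨c', hc', d', hd', hcd'⟩ := hcomp
    have hC2 : ∀ p ∈ C, p = c ∨ p = c' := fun p hp => by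
      rw [hC] at hcC hc' hp
      rw [hD] at hd'
      exact h.eq_or_eq_of_not_lt hcd hc'.1 hd'.1 hp.1 hc'.2 hp.2 hcC.2 hd'.2 hcd'
    have hD2 : ∀ p ∈ D, p = d ∨ p = d' := fun p hp => by
      rw [hD] at hdD hd' hp
      rw [hC] at hc'
      exact h.flip_lt.eq_or_eq_of_not_lt (c := d) (c' := d') (d := c) (d' := c')
        hcd hd'.1 hc'.1 hp.1 hd'.2 hp.2 hdD.2 hc'.2 hcd'
    rw [hC] at hcC hc'
    rw [hD] at hdD hd'
    refine Or.inr (Or.inr ⟨c, c', d, d', hcd, hc'.1, hd'.1, ?_, ?_, hcC.2 _ hc'.1,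
      hc'.2 _ hcd, hd'.2 _ hcd, hdD.2 _ hd'.1, hcd', fun h1 => ?_, fun p => ?_⟩)
    · rintro rfl
      exact hcd' hd'.1
    · rintro rfl
      exact hcd' hc'.1
    · exact hno d' ⟨hd'.1, h.lt_trans _ _ _ h1 hc'.1⟩
    · rcases hcov p with h1 | h1 | ⟨r, hr, h1⟩ | ⟨r, hr, h1⟩
      · rcases hC2 p h1 with rfl | rfl <;> simp
      · rcases hD2 p h1 with rfl | rfl <;> simp
      · rcases hC2 r hr with rfl | rfl <;> simp [h1]
      · rcases hD2 r hr with rfl | rfl <;> simp [h1]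

theorem splits [Fintype α] (h : SparseConjugate lt tri) {x y z : α} (hne : y ≠ z)
    (hxy : lt x y ∨ lt y x) (hxz : lt x z ∨ lt z x) : Splits lt := by
  refine h.splits_of_hasSpanningCover (h.hasSpanningCover hne hxy hxz) fun a b => ?_
  have hirr := h.lt_irrefl
  have hyx : y ≠ x := by
    rintro rfl
    exact hirr y (by tauto)
  have hzx : z ≠ x := by
    rintro rfl
    exact hirr z (by tauto)
  by_contra! hc
  have h1 : x = a ∨ x = b := or_iff_not_imp_left.mpr (hc x)
  have h2 : y = a ∨ y = b := or_iff_not_imp_left.mpr (hc y)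
  have h3 : z = a ∨ z = b := or_iff_not_imp_left.mpr (hc z)
  grind

end SparseConjugate

end ConjugateOrders

theorem exists_bruhatLE_move_left {m : ℕ} (z : Equiv.Perm (Fin m)) (k : Fin m) :
    ∀ (d : ℕ) (i : Fin m), (i : ℕ) + d = k → (∀ j, i ≤ j → j < k → z j < z k) →
      ∃ y, BruhatLE z y ∧ y i = z k ∧
        (∀ j j' : Fin m, i ≤ j' → (j' : ℕ) + 1 = j → j ≤ k → y j = z j') ∧
        ∀ j, j < i ∨ k < j → y j = z j := by
  intro d
  induction d with
  | zero =>
    intro i hi h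
    obtain rfl : i = k := Fin.ext (by simpa using hi)
    refine ⟨z, Relation.ReflTransGen.refl, rfl, fun j j' h1 h2 h3 => ?_, fun _ _ => rfl⟩
    rw [Fin.le_def] at h1 h3
    omega
  | succ d ih =>
    intro i hi h
    have hk := k.isLt
    obtain ⟨i', hi'⟩ : ∃ i' : Fin m, (i' : ℕ) = i + 1 := ⟨⟨i + 1, by omega⟩, rfl⟩
    obtain ⟨y, hzy, h1, h2, h3⟩ := ih i' (by omega) (fun j hj hjk => h j (by grind) hjk)
    have hii : i < i' := by grind
    have hyi := h3 i (Or.inl hii)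
    refine ⟨y * Equiv.swap i i', hzy.trans (BruhatLE.swap _ hii ?_), ?_, ?_, ?_⟩
    · rw [hyi, h1]
      exact h i le_rfl (by grind)
    · simpa using h1
    · intro j j' hj' hjj hjk
      rw [Equiv.Perm.mul_apply]
      by_cases hj : j = i'
      · subst hj
        rw [Equiv.swap_apply_right, hyi]
        congr 1
        grind
      · rw [Equiv.swap_apply_of_ne_of_ne (by grind) hj]
        exact h2 j j' (by grind) hjj hjk
    · intro j hj
      rw [Equiv.Perm.mul_apply, Equiv.swap_apply_of_ne_of_ne (by grind) (by grind)]
      exact h3 j (by grind)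

theorem exists_bruhatLE_move_right {m : ℕ} (z : Equiv.Perm (Fin m)) (k : Fin m) :
    ∀ (d : ℕ) (i : Fin m), (k : ℕ) + d = i → (∀ j, k < j → j ≤ i → z k < z j) →
      ∃ y, BruhatLE z y ∧ y i = z k ∧
        (∀ j j' : Fin m, k ≤ j → (j : ℕ) + 1 = j' → j' ≤ i → y j = z j') ∧
        ∀ j, j < k ∨ i < j → y j = z j := by
  intro d
  induction d with
  | zero =>
    intro i hi h
    obtain rfl : k = i := Fin.ext (by simpa using hi)
    refine ⟨z, Relation.ReflTransGen.refl, rfl, fun j j' h1 h2 h3 => ?_, fun _ _ => rfl⟩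
    rw [Fin.le_def] at h1 h3
    omega
  | succ d ih =>
    intro i hi h
    have hi' := i.isLt
    obtain ⟨i', hi'⟩ : ∃ i' : Fin m, (i' : ℕ) + 1 = i := ⟨⟨i - 1, by omega⟩, by simp; omega⟩
    obtain ⟨y, hzy, h1, h2, h3⟩ := ih i' (by omega) (fun j hj hjk => h j hj (by grind))
    have hii : i' < i := by grind
    have hyi := h3 i (Or.inr hii)
    refine ⟨y * Equiv.swap i' i, hzy.trans (BruhatLE.swap _ hii ?_), ?_, ?_, ?_⟩
    · rw [hyi, h1]
      exact h i (by grind) le_rfl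
    · simpa using h1
    · intro j j' hj' hjj hjk
      rw [Equiv.Perm.mul_apply]
      by_cases hj : j = i'
      · subst hj
        rw [Equiv.swap_apply_left, hyi]
        congr 1
        grind
      · rw [Equiv.swap_apply_of_ne_of_ne hj (by grind)]
        exact h2 j j' hj' hjj (by grind)
    · intro j hj
      rw [Equiv.Perm.mul_apply, Equiv.swap_apply_of_ne_of_ne (by grind) (by grind)]
      exact h3 j (by grind)

theorem exists_familyA_perms (a b : ℕ) : ∃ u v : Equiv.Perm (Fin (a + b + 2)), BruhatLE u v ∧
    (∀ i : Fin (a + b + 2), (i : ℕ) ≤ a → (u i : ℕ) = a - i) ∧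
    (∀ i : Fin (a + b + 2), a < (i : ℕ) → (u i : ℕ) = 2 * a + b + 2 - i) ∧
    (∀ i : Fin (a + b + 2), (i : ℕ) = 0 → (v i : ℕ) = a + b + 1) ∧
    (∀ i : Fin (a + b + 2), 1 ≤ (i : ℕ) → (i : ℕ) ≤ a → (v i : ℕ) = a + 1 - i) ∧
    (∀ i : Fin (a + b + 2), a < (i : ℕ) → (i : ℕ) ≤ a + b → (v i : ℕ) = 2 * a + b + 1 - i) ∧
    (∀ i : Fin (a + b + 2), (i : ℕ) = a + b + 1 → (v i : ℕ) = 0) := by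
  let g : Fin (a + b + 2) → Fin (a + b + 2) := fun i =>
    if h : (i : ℕ) ≤ a then ⟨a - i, by omega⟩ else ⟨2 * a + b + 2 - i, by omega⟩
  have hg1 : ∀ i : Fin (a + b + 2), (i : ℕ) ≤ a → (g i : ℕ) = a - i := fun i h => by simp [g, h]
  have hg2 : ∀ i : Fin (a + b + 2), a < (i : ℕ) → (g i : ℕ) = 2 * a + b + 2 - i := fun i h => by
    simp [g, not_le.mpr h]
  have hg : Function.Involutive g := by
    intro i
    apply Fin.ext
    by_cases h : (i : ℕ) ≤ a
    · rw [hg1 _ (by rw [hg1 i h]; omega), hg1 i h]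
      omega
    · have := i.isLt
      rw [hg2 _ (by rw [hg2 i (by omega)]; omega), hg2 i (by omega)]
      omega
  obtain ⟨u, hu⟩ : ∃ u : Equiv.Perm (Fin (a + b + 2)), ∀ i, u i = g i :=
    ⟨hg.toPerm, fun _ => rfl⟩
  have hu1 : ∀ i : Fin (a + b + 2), (i : ℕ) ≤ a → (u i : ℕ) = a - i := fun i h => by rw [hu, hg1 i h]
  have hu2 : ∀ i : Fin (a + b + 2), a < (i : ℕ) → (u i : ℕ) = 2 * a + b + 2 - i := fun i h => by rw [hu, hg2 i h]
  let k : Fin (a + b + 2) := ⟨a + 1, by omega⟩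
  have huk : (u k : ℕ) = a + b + 1 := by
    rw [hu2 k (Nat.lt_succ_self a)]
    simp only [k]
    omega
  obtain ⟨y, huy, y1, y2, y3⟩ := exists_bruhatLE_move_left u k (a + 1) 0 (by simp [k])
    (fun j _ hj => by
      have h1 : (j : ℕ) < a + 1 := hj
      rw [Fin.lt_def, huk, hu1 j (by omega)]
      omega)
  have hy0 : ∀ i : Fin (a + b + 2), (i : ℕ) = 0 → (y i : ℕ) = a + b + 1 := by
    intro i hi
    obtain rfl : i = 0 := Fin.ext hi
    rw [y1, huk]
  have hy1 : ∀ i : Fin (a + b + 2), 1 ≤ (i : ℕ) → (i : ℕ) ≤ a + 1 → (y i : ℕ) = a + 1 - i := by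
    intro i hi hia
    rw [y2 i ⟨i - 1, by omega⟩ (Fin.zero_le _) (by simp; omega) (by simp [Fin.le_def, k, hia]),
      hu1 _ (by simp; omega)]
    simp
    omega
  have hy2 : ∀ i : Fin (a + b + 2), a + 1 < (i : ℕ) → (y i : ℕ) = 2 * a + b + 2 - i := by
    intro i hi
    rw [y3 i (Or.inr hi), hu2 i (by omega)]
  have hyk : (y k : ℕ) = 0 := by
    rw [hy1 k (by simp [k]) (by simp [k])]
    simp [k]
  obtain ⟨v, hyv, v1, v2, v3⟩ := exists_bruhatLE_move_right y k b (Fin.last _) (by simp [k]; omega)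
    (fun j hj _ => by
      have h1 : a + 1 < (j : ℕ) := hj
      rw [Fin.lt_def, hyk, hy2 j h1]
      omega)
  refine ⟨u, v, huy.trans hyv, hu1, hu2, ?_, ?_, ?_, ?_⟩
  · intro i hi
    rw [v3 i (Or.inl (by simp [Fin.lt_def, k, hi])), hy0 i hi]
  · intro i hi hia
    rw [v3 i (Or.inl (by simp [Fin.lt_def, k]; omega)), hy1 i hi (by omega)]
  · intro i hi hib
    rw [v2 i ⟨i + 1, by omega⟩ hi rfl (Fin.le_last _), hy2 _ (by simp; omega)]
    simp
  · intro i hi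
    obtain rfl : i = Fin.last _ := Fin.ext hi
    rw [v1, hyk]

theorem lt_iff_lt_of_imp {ι : Type*} {m n : ℕ} {s : ι → Fin n} {t : ι → Fin m}
    (h : ∀ j k, t j < t k → s j < s k)
    (ht : Function.Injective t) (j k : ι) : s j < s k ↔ t j < t k := by
  refine ⟨fun hlt => ?_, h j k⟩
  rcases lt_trichotomy (t j) (t k) with h1 | h1 | h1
  · exact h1
  · rw [ht h1] at hlt
    exact absurd hlt (lt_irrefl _)
  · exact absurd (h _ _ h1) hlt.not_gt

theorem exists_familyA_embeds {n a b : ℕ} (w : Equiv.Perm (Fin n)) (ha : 1 ≤ a) (hb : 1 ≤ b)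
    (hab : ¬ (a = 1 ∧ b = 1)) (T B : Fin n) (c : Fin a → Fin n) (d : Fin b → Fin n)
    (hc : ∀ i j, i < j → c i < c j ∧ w (c j) < w (c i))
    (hd : ∀ i j, i < j → d i < d j ∧ w (d j) < w (d i))
    (hcd : ∀ i j, c i < d j ∧ w (c i) < w (d j))
    (hcr : ∀ i, T < c i ∧ c i < B ∧ w B < w (c i) ∧ w (c i) < w T)
    (hdr : ∀ i, T < d i ∧ d i < B ∧ w B < w (d i) ∧ w (d i) < w T)
    (hcov : ∀ p, T < p → p < B → w B < w p → w p < w T →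
      (∃ i, p = c i ∨ p < c i ∧ w p < w (c i)) ∨ ∃ i, p = d i ∨ d i < p ∧ w (d i) < w p) :
    ∃ (m : ℕ) (u v : Equiv.Perm (Fin m)), IntervalEmbeds u v w ∧ InFamilyA u v := by
  obtain ⟨u, v, huv, u1, u2, v1, v2, v3, v4⟩ := exists_familyA_perms a b
  refine ⟨_, u, v, ?_, a, b, ha, hb, hab, rfl, ?_⟩
  · obtain ⟨f, hcases⟩ : ∃ f : Fin (a + b + 2) → Fin n, ∀ j : Fin (a + b + 2),
        ((j : ℕ) = 0 ∧ f j = T) ∨ (∃ i : Fin a, (j : ℕ) = i + 1 ∧ f j = c i) ∨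
        (∃ i : Fin b, (j : ℕ) = i + 1 + a ∧ f j = d i) ∨ ((j : ℕ) = a + b + 1 ∧ f j = B) := by
      refine ⟨fun j : Fin (a + b + 2) => if j.val = 0 then T else if h : j.val - 1 < a then c ⟨j - 1, h⟩
        else if h : j.val - 1 - a < b then d ⟨j - 1 - a, h⟩ else B, fun j => ?_⟩
      by_cases h0 : (j : ℕ) = 0
      · exact Or.inl ⟨h0, if_pos h0⟩
      by_cases h1 : (j : ℕ) - 1 < a
      · exact Or.inr (Or.inl ⟨⟨j - 1, h1⟩, by simp; omega, (if_neg h0).trans (dif_pos h1)⟩)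
      by_cases h2 : (j : ℕ) - 1 - a < b
      · exact Or.inr (Or.inr (Or.inl ⟨⟨j - 1 - a, h2⟩, by simp; omega,
          (if_neg h0).trans ((dif_neg h1).trans (dif_pos h2))⟩))
      · exact Or.inr (Or.inr (Or.inr ⟨by omega,
          (if_neg h0).trans ((dif_neg h1).trans (dif_neg h2))⟩))
    have hTB : T < B ∧ w B < w T :=
      have h := hcr ⟨0, by omega⟩
      ⟨h.1.trans h.2.1, h.2.2.1.trans h.2.2.2⟩
    have hf : StrictMono f := by
      intro j k hjk
      rw [Fin.lt_def] at hjk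
      rcases hcases j with ⟨hj, ej⟩ | ⟨i, hj, ej⟩ | ⟨i, hj, ej⟩ | ⟨hj, ej⟩ <;>
      rcases hcases k with ⟨hk, ek⟩ | ⟨l, hk, ek⟩ | ⟨l, hk, ek⟩ | ⟨hk, ek⟩ <;>
      rw [ej, ek] <;>
      first
        | exact (hcr _).1 | exact (hcr _).2.1 | exact (hdr _).1 | exact (hdr _).2.1
        | exact hTB.1 | exact (hcd _ _).1 | exact (hc _ _ (Fin.lt_def.mpr (by omega))).1
        | exact (hd _ _ (Fin.lt_def.mpr (by omega))).1 | omega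
    have hvcases : ∀ j : Fin (a + b + 2), ((v j : ℕ) = a + b + 1 ∧ f j = T) ∨
        (∃ i : Fin a, (v j : ℕ) + i = a ∧ f j = c i) ∨
        (∃ i : Fin b, (v j : ℕ) + i = a + b ∧ f j = d i) ∨ ((v j : ℕ) = 0 ∧ f j = B) := by
      intro j
      rcases hcases j with ⟨hj, ej⟩ | ⟨i, hj, ej⟩ | ⟨i, hj, ej⟩ | ⟨hj, ej⟩
      · exact Or.inl ⟨v1 j hj, ej⟩
      · exact Or.inr (Or.inl ⟨i, by rw [v2 j (by omega) (by omega)]; omega, ej⟩)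
      · exact Or.inr (Or.inr (Or.inl ⟨i, by rw [v3 j (by omega) (by omega)]; omega, ej⟩))
      · exact Or.inr (Or.inr (Or.inr ⟨v4 j hj, ej⟩))
    have hw : ∀ j k, v j < v k → w (f j) < w (f k) := by
      intro j k hjk
      rw [Fin.lt_def] at hjk
      rcases hvcases j with ⟨hj, ej⟩ | ⟨i, hj, ej⟩ | ⟨i, hj, ej⟩ | ⟨hj, ej⟩ <;>
      rcases hvcases k with ⟨hk, ek⟩ | ⟨l, hk, ek⟩ | ⟨l, hk, ek⟩ | ⟨hk, ek⟩ <;>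
      rw [ej, ek] <;>
      first
        | exact (hcr _).2.2.1 | exact (hcr _).2.2.2 | exact (hdr _).2.2.1 | exact (hdr _).2.2.2
        | exact hTB.2 | exact (hcd _ _).2 | exact (hc _ _ (Fin.lt_def.mpr (by omega))).2
        | exact (hd _ _ (Fin.lt_def.mpr (by omega))).2 | omega
    refine IntervalEmbeds.of_points (f := ⟨f, hf.injective⟩) huv hf
      (lt_iff_lt_of_imp (s := fun j => w (f j)) hw v.injective) ?_
    simp only [Function.Embedding.coeFn_mk]
    intro p hp
    have hfc : ∀ i : Fin a, ∃ k : Fin (a + b + 2), (k : ℕ) = i + 1 ∧ f k = c i := fun i => by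
      refine ⟨⟨i + 1, by omega⟩, rfl, ?_⟩
      rcases hcases ⟨i + 1, by omega⟩ with ⟨hj, ej⟩ | ⟨l, hj, ej⟩ | ⟨l, hj, ej⟩ | ⟨hj, ej⟩ <;>
      simp only at hj
      · omega
      · rw [ej, show l = i from Fin.ext (by omega)]
      · omega
      · omega
    have hfd : ∀ i : Fin b, ∃ k : Fin (a + b + 2), (k : ℕ) = i + 1 + a ∧ f k = d i := fun i => by
      refine ⟨⟨i + 1 + a, by omega⟩, rfl, ?_⟩
      rcases hcases ⟨i + 1 + a, by omega⟩ with ⟨hj, ej⟩ | ⟨l, hj, ej⟩ | ⟨l, hj, ej⟩ | ⟨hj, ej⟩ <;>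
      simp only at hj
      · omega
      · omega
      · rw [ej, show l = i from Fin.ext (by omega)]
      · omega
    have hfT : ∃ k, f k = T := by
      refine ⟨⟨0, by omega⟩, ?_⟩
      rcases hcases ⟨0, by omega⟩ with ⟨hj, ej⟩ | ⟨l, hj, ej⟩ | ⟨l, hj, ej⟩ | ⟨hj, ej⟩ <;>
      simp only at hj <;> first | exact ej | omega
    have hfB : ∃ k, f k = B := by
      refine ⟨⟨a + b + 1, by omega⟩, ?_⟩
      rcases hcases ⟨a + b + 1, by omega⟩ with ⟨hj, ej⟩ | ⟨l, hj, ej⟩ | ⟨l, hj, ej⟩ | ⟨hj, ej⟩ <;>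
      simp only at hj <;> first | exact ej | omega
    have hpT : p ≠ T := fun h => hp (h ▸ hfT)
    have hpB : p ≠ B := fun h => hp (h ▸ hfB)
    have hwpT : w p ≠ w T := fun h => hpT (w.injective h)
    have hwpB : w p ≠ w B := fun h => hpB (w.injective h)
    have hbox : ∀ j, T ≤ f j ∧ f j ≤ B ∧ w B ≤ w (f j) ∧ w (f j) ≤ w T := by
      intro j
      rcases hcases j with ⟨hj, ej⟩ | ⟨i, hj, ej⟩ | ⟨i, hj, ej⟩ | ⟨hj, ej⟩ <;> rw [ej]
      · exact ⟨le_rfl, hTB.1.le, hTB.2.le, le_rfl⟩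
      · exact ⟨(hcr i).1.le, (hcr i).2.1.le, (hcr i).2.2.1.le, (hcr i).2.2.2.le⟩
      · exact ⟨(hdr i).1.le, (hdr i).2.1.le, (hdr i).2.2.1.le, (hdr i).2.2.2.le⟩
      · exact ⟨hTB.1.le, le_rfl, le_rfl, hTB.2.le⟩
    by_cases q1 : T < p
    swap
    · exact Or.inl (Or.inl fun j => (lt_of_le_of_ne (not_lt.mp q1) hpT).trans_le (hbox j).1)
    by_cases q2 : p < B
    swap
    · exact Or.inl (Or.inr (Or.inl fun j =>
        (hbox j).2.1.trans_lt (lt_of_le_of_ne (not_lt.mp q2) hpB.symm)))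
    by_cases q3 : w B < w p
    swap
    · exact Or.inl (Or.inr (Or.inr (Or.inl fun j =>
        (lt_of_le_of_ne (not_lt.mp q3) hwpB).trans_le (hbox j).2.2.1)))
    by_cases q4 : w p < w T
    swap
    · exact Or.inl (Or.inr (Or.inr (Or.inr fun j =>
        (hbox j).2.2.2.trans_lt (lt_of_le_of_ne (not_lt.mp q4) hwpT.symm))))
    right
    rcases hcov p q1 q2 q3 q4 with ⟨i, hi⟩ | ⟨i, hi⟩
    · obtain ⟨k, hk, ek⟩ := hfc i
      rcases hi with hi | hi
      · exact absurd ⟨k, ek.trans hi.symm⟩ hp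
      refine Or.inl ⟨k, fun j hj => ?_, by rw [ek]; exact hi.1, by rw [ek]; exact hi.2⟩
      rw [Fin.lt_def] at hj
      have hi := i.isLt
      rw [Fin.le_def, Fin.le_def, v2 k (by omega) (by omega), u1 j (by omega)]
      refine ⟨?_, by omega⟩
      by_cases hj0 : (j : ℕ) = 0
      · rw [v1 j hj0]
        omega
      · rw [v2 j (by omega) (by omega)]
        omega
    · obtain ⟨k, hk, ek⟩ := hfd i
      rcases hi with hi | hi
      · exact absurd ⟨k, ek.trans hi.symm⟩ hp
      refine Or.inr ⟨k, fun j hj => ?_, by rw [ek]; exact hi.1, by rw [ek]; exact hi.2⟩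
      rw [Fin.lt_def] at hj
      have hi := i.isLt
      have hjl := j.isLt
      rw [Fin.le_def, Fin.le_def, v3 k (by omega) (by omega), u2 j (by omega)]
      refine ⟨?_, by omega⟩
      by_cases hj0 : (j : ℕ) = a + b + 1
      · rw [v4 j hj0]
        omega
      · rw [v3 j (by omega) (by omega)]
        omega
  · have hp : ∀ (z : Equiv.Perm (Fin (a + b + 2))) (i : ℕ) (h1 : 1 ≤ i) (h2 : i ≤ a + b + 2),
        pval z i = (z ⟨i - 1, by omega⟩ : ℕ) + 1 := by
      intro z i h1 h2
      simp [pval, h1, h2]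
    refine ⟨?_, ?_, ?_, ?_, ?_, ?_⟩
    · intro i h1 h2
      rw [hp _ _ h1 (by omega), u1 _ (by simp; omega)]
      simp
      omega
    · intro i h1 h2
      rw [hp _ _ (by omega) h2, u2 _ (by simp; omega)]
      simp
      omega
    · rw [hp _ _ le_rfl (by omega), v1 _ (by simp)]
    · intro i h1 h2
      rw [hp _ _ (by omega) (by omega), v2 _ (by simp; omega) (by simp; omega)]
      simp
      omega
    · intro i h1 h2
      rw [hp _ _ (by omega) (by omega), v3 _ (by simp; omega) (by simp; omega)]
      simp
      omega
    · rw [hp _ _ (by omega) le_rfl, v4 _ (by simp)]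

theorem IntervalEmbeds.of_rectangle {m n : ℕ} {u v : Equiv.Perm (Fin (m + 2))}
    {w : Equiv.Perm (Fin n)} {f g : Fin (m + 2) → Fin n} (huv : BruhatLE u v)
    (hf : StrictMono f) (hg : StrictMono g) (hfg : ∀ j, g (v j) = w (f j))
    (hfirst : v 0 = Fin.last (m + 1)) (hlast : v (Fin.last (m + 1)) = 0)
    (hcov : ∀ p, f 0 < p → p < f (Fin.last (m + 1)) → w (f (Fin.last (m + 1))) < w p →
      w p < w (f 0) → (∃ j, f j = p) ∨
        (∃ k, (∀ j < k, v k ≤ v j ∧ v k ≤ u j) ∧ p < f k ∧ w p < w (f k)) ∨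
        ∃ k, (∀ j, k < j → v j ≤ v k ∧ u j ≤ v k) ∧ f k < p ∧ w (f k) < w p) :
    IntervalEmbeds u v w := by
  refine IntervalEmbeds.of_points (f := ⟨f, hf.injective⟩) huv hf
    (fun j k => by simp only [Function.Embedding.coeFn_mk, ← hfg, hg.lt_iff_lt]) ?_
  simp only [Function.Embedding.coeFn_mk]
  intro p hp
  have hne : ∀ j, p ≠ f j := fun j h => hp ⟨j, h.symm⟩
  have hwne : ∀ j, w p ≠ w (f j) := fun j h => hne j (w.injective h)
  have hwbox : ∀ j, w (f (Fin.last (m + 1))) ≤ w (f j) ∧ w (f j) ≤ w (f 0) := fun j => by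
    simp only [← hfg, hfirst, hlast, hg.le_iff_le, Fin.zero_le, Fin.le_last, and_self]
  by_cases q1 : f 0 < p
  swap
  · exact Or.inl (Or.inl fun j =>
      (lt_of_le_of_ne (not_lt.mp q1) (hne 0)).trans_le (hf.monotone (Fin.zero_le j)))
  by_cases q2 : p < f (Fin.last (m + 1))
  swap
  · exact Or.inl (Or.inr (Or.inl fun j =>
      (hf.monotone (Fin.le_last j)).trans_lt (lt_of_le_of_ne (not_lt.mp q2) (hne _).symm)))
  by_cases q3 : w (f (Fin.last (m + 1))) < w p
  swap
  · exact Or.inl (Or.inr (Or.inr (Or.inl fun j =>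
      (lt_of_le_of_ne (not_lt.mp q3) (hwne _)).trans_le (hwbox j).1)))
  by_cases q4 : w p < w (f 0)
  swap
  · exact Or.inl (Or.inr (Or.inr (Or.inr fun j =>
      (hwbox j).2.trans_lt (lt_of_le_of_ne (not_lt.mp q4) (hwne _).symm))))
  exact Or.inr ((hcov p q1 q2 q3 q4).resolve_left hp)

theorem exists_embeds_21354_52341 {n : ℕ} (w : Equiv.Perm (Fin n)) {T c m d B : Fin n}
    (h1 : T < c) (h2 : c < m) (h3 : m < d) (h4 : d < B)
    (k1 : w B < w c) (k2 : w c < w m) (k3 : w m < w d) (k4 : w d < w T)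
    (hcov : ∀ p, T < p → p < B → w B < w p → w p < w T →
      p = c ∨ p = m ∨ p = d ∨ (p < c ∧ w p < w c) ∨ (d < p ∧ w d < w p)) :
    ∃ (l : ℕ) (u v : Equiv.Perm (Fin l)), IntervalEmbeds u v w ∧
      OneLine u [2, 1, 3, 5, 4] ∧ OneLine v [5, 2, 3, 4, 1] := by
  let u : Equiv.Perm (Fin 5) := ⟨![1, 0, 2, 4, 3], ![1, 0, 2, 4, 3], by decide, by decide⟩
  let v : Equiv.Perm (Fin 5) := ⟨![4, 1, 2, 3, 0], ![4, 1, 2, 3, 0], by decide, by decide⟩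
  have huv : BruhatLE u v := by
    have e : v = u * Equiv.swap 0 3 * Equiv.swap 1 3 * Equiv.swap 3 4 := by decide
    rw [e]
    exact ((BruhatLE.swap _ (by decide) (by decide)).trans
      (BruhatLE.swap _ (by decide) (by decide))).trans (BruhatLE.swap _ (by decide) (by decide))
  refine ⟨5, u, v, IntervalEmbeds.of_rectangle (f := ![T, c, m, d, B])
    (g := ![w B, w c, w m, w d, w T]) huv ?_ ?_ ?_ rfl rfl ?_, ?_, ?_⟩
  · simp [strictMono_vecCons, *]
  · simp [strictMono_vecCons, *]
  · intro j
    fin_cases j <;> rfl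
  · intro p q1 q2 q3 q4
    rcases hcov p q1 q2 q3 q4 with h | h | h | h | h
    · exact Or.inl ⟨1, h.symm⟩
    · exact Or.inl ⟨2, h.symm⟩
    · exact Or.inl ⟨3, h.symm⟩
    · exact Or.inr (Or.inl ⟨1, by decide, h⟩)
    · exact Or.inr (Or.inr ⟨3, by decide, h⟩)
  · exact ⟨rfl, by decide⟩
  · exact ⟨rfl, by decide⟩

theorem exists_embeds_421653_642531 {n : ℕ} (w : Equiv.Perm (Fin n)) {T c' c d d' B : Fin n}
    (h1 : T < c') (h2 : c' < c) (h3 : c < d) (h4 : d < d') (h5 : d' < B)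
    (k1 : w B < w c) (k2 : w c < w d') (k3 : w d' < w c') (k4 : w c' < w d) (k5 : w d < w T)
    (hcov : ∀ p, T < p → p < B → w B < w p → w p < w T →
      p = c ∨ p = c' ∨ p = d ∨ p = d' ∨ (p < c ∧ w p < w c) ∨ (p < c' ∧ w p < w c') ∨
        (d < p ∧ w d < w p) ∨ (d' < p ∧ w d' < w p)) :
    ∃ (l : ℕ) (u v : Equiv.Perm (Fin l)), IntervalEmbeds u v w ∧
      OneLine u [4, 2, 1, 6, 5, 3] ∧ OneLine v [6, 4, 2, 5, 3, 1] := by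
  let u : Equiv.Perm (Fin 6) :=
    ⟨![3, 1, 0, 5, 4, 2], ![2, 1, 5, 0, 4, 3], by decide, by decide⟩
  let v : Equiv.Perm (Fin 6) :=
    ⟨![5, 3, 1, 4, 2, 0], ![5, 2, 4, 1, 3, 0], by decide, by decide⟩
  have huv : BruhatLE u v := by
    have e : v = u * Equiv.swap 0 3 * Equiv.swap 1 3 * Equiv.swap 2 3 * Equiv.swap 3 4 *
      Equiv.swap 4 5 := by decide
    rw [e]
    exact ((((BruhatLE.swap _ (by decide) (by decide)).trans
      (BruhatLE.swap _ (by decide) (by decide))).trans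
      (BruhatLE.swap _ (by decide) (by decide))).trans
      (BruhatLE.swap _ (by decide) (by decide))).trans (BruhatLE.swap _ (by decide) (by decide))
  refine ⟨6, u, v, IntervalEmbeds.of_rectangle (f := ![T, c', c, d, d', B])
    (g := ![w B, w c, w d', w c', w d, w T]) huv ?_ ?_ ?_ rfl rfl ?_, ?_, ?_⟩
  · simp [strictMono_vecCons, *]
  · simp [strictMono_vecCons, *]
  · intro j
    fin_cases j <;> rfl
  · intro p q1 q2 q3 q4
    rcases hcov p q1 q2 q3 q4 with h | h | h | h | h | h | h | h
    · exact Or.inl ⟨2, h.symm⟩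
    · exact Or.inl ⟨1, h.symm⟩
    · exact Or.inl ⟨3, h.symm⟩
    · exact Or.inl ⟨4, h.symm⟩
    · exact Or.inr (Or.inl ⟨2, by decide, h⟩)
    · exact Or.inr (Or.inl ⟨1, by decide, h⟩)
    · exact Or.inr (Or.inr ⟨3, by decide, h⟩)
    · exact Or.inr (Or.inr ⟨4, by decide, h⟩)
  · exact ⟨rfl, by decide⟩
  · exact ⟨rfl, by decide⟩

theorem exists_embeds_326154_635241 {n : ℕ} (w : Equiv.Perm (Fin n)) {T c d' c' d B : Fin n}
    (h1 : T < c) (h2 : c < d') (h3 : d' < c') (h4 : c' < d) (h5 : d < B)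
    (k1 : w B < w c') (k2 : w c' < w c) (k3 : w c < w d) (k4 : w d < w d') (k5 : w d' < w T)
    (hcov : ∀ p, T < p → p < B → w B < w p → w p < w T →
      p = c ∨ p = c' ∨ p = d ∨ p = d' ∨ (p < c ∧ w p < w c) ∨ (p < c' ∧ w p < w c') ∨
        (d < p ∧ w d < w p) ∨ (d' < p ∧ w d' < w p)) :
    ∃ (l : ℕ) (u v : Equiv.Perm (Fin l)), IntervalEmbeds u v w ∧
      OneLine u [3, 2, 6, 1, 5, 4] ∧ OneLine v [6, 3, 5, 2, 4, 1] := by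
  let u : Equiv.Perm (Fin 6) :=
    ⟨![2, 1, 5, 0, 4, 3], ![3, 1, 0, 5, 4, 2], by decide, by decide⟩
  let v : Equiv.Perm (Fin 6) :=
    ⟨![5, 2, 4, 1, 3, 0], ![5, 3, 1, 4, 2, 0], by decide, by decide⟩
  have huv : BruhatLE u v := by
    have e : v = u * Equiv.swap 0 2 * Equiv.swap 1 2 * Equiv.swap 2 4 * Equiv.swap 3 4 *
      Equiv.swap 4 5 := by decide
    rw [e]
    exact ((((BruhatLE.swap _ (by decide) (by decide)).trans
      (BruhatLE.swap _ (by decide) (by decide))).trans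
      (BruhatLE.swap _ (by decide) (by decide))).trans
      (BruhatLE.swap _ (by decide) (by decide))).trans (BruhatLE.swap _ (by decide) (by decide))
  refine ⟨6, u, v, IntervalEmbeds.of_rectangle (f := ![T, c, d', c', d, B])
    (g := ![w B, w c', w c, w d, w d', w T]) huv ?_ ?_ ?_ rfl rfl ?_, ?_, ?_⟩
  · simp [strictMono_vecCons, *]
  · simp [strictMono_vecCons, *]
  · intro j
    fin_cases j <;> rfl
  · intro p q1 q2 q3 q4
    rcases hcov p q1 q2 q3 q4 with h | h | h | h | h | h | h | h
    · exact Or.inl ⟨1, h.symm⟩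
    · exact Or.inl ⟨3, h.symm⟩
    · exact Or.inl ⟨4, h.symm⟩
    · exact Or.inl ⟨2, h.symm⟩
    · exact Or.inr (Or.inl ⟨1, by decide, h⟩)
    · exact Or.inr (Or.inl ⟨3, by decide, h⟩)
    · exact Or.inr (Or.inr ⟨4, by decide, h⟩)
    · exact Or.inr (Or.inr ⟨2, by decide, h⟩)
  · exact ⟨rfl, by decide⟩
  · exact ⟨rfl, by decide⟩

/-- Strictly between the positions `T` and `B`, and with values strictly between `w B` and `w T`,
there is a position forming a non-inversion of `w` with at least two others. -/
def HasNoninversionPath {n : ℕ} (w : Equiv.Perm (Fin n)) (T B : Fin n) : Prop :=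
  ∃ x y z : {p : Fin n // T < p ∧ p < B ∧ w B < w p ∧ w p < w T}, y ≠ z ∧
    ((x.1 < y.1 ∧ w x < w y) ∨ (y.1 < x.1 ∧ w y < w x)) ∧
    ((x.1 < z.1 ∧ w x < w z) ∨ (z.1 < x.1 ∧ w z < w x))

theorem HasNoninversionPath.splits {n : ℕ} {w : Equiv.Perm (Fin n)} {T B : Fin n}
    (h : HasNoninversionPath w T B)
    (hmin : ∀ T' B', T ≤ T' → B' ≤ B → (T < T' ∨ B' < B) → ¬ HasNoninversionPath w T' B') :
    Splits fun p q : {p : Fin n // T < p ∧ p < B ∧ w B < w p ∧ w p < w T} =>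
      p.1 < q.1 ∧ w p < w q := by
  have hS : SparseConjugate (α := {p : Fin n // T < p ∧ p < B ∧ w B < w p ∧ w p < w T})
      (fun p q => p.1 < q.1 ∧ w p < w q) (fun p q => p.1 < q.1 ∧ w q < w p) :=
    { lt_trans := fun a b c hab hbc => ⟨hab.1.trans hbc.1, hab.2.trans hbc.2⟩
      lt_irrefl := fun a ha => lt_irrefl _ ha.1
      tri_trans := fun a b c hab hbc => ⟨hab.1.trans hbc.1, hbc.2.trans hab.2⟩
      tri_irrefl := fun a ha => lt_irrefl _ ha.1
      total := fun a b => by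
        by_cases hab : a = b
        · exact Or.inl hab
        have h1 : a.1 ≠ b.1 := fun h => hab (Subtype.ext h)
        have h2 : w a ≠ w b := fun h => h1 (w.injective h)
        rcases lt_or_gt_of_ne h1 with h1 | h1 <;> rcases lt_or_gt_of_ne h2 with h2 | h2 <;>
          simp [h1, h2]
      disjoint := fun a b hab => ⟨fun h => h.2.not_gt hab.2, fun h => h.1.not_gt hab.1⟩
      sparse_right := fun e x y z hx hy hz hyz hxy hxz =>
        hmin e B e.2.1.le le_rfl (Or.inl e.2.1)
          ⟨⟨x, hx.1, x.2.2.1, x.2.2.2.1, hx.2⟩, ⟨y, hy.1, y.2.2.1, y.2.2.2.1, hy.2⟩,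
            ⟨z, hz.1, z.2.2.1, z.2.2.2.1, hz.2⟩,
            fun h => hyz (Subtype.ext (Subtype.mk.inj h)), hxy, hxz⟩
      sparse_left := fun e x y z hx hy hz hyz hxy hxz =>
        hmin T e le_rfl e.2.2.1.le (Or.inr e.2.2.1)
          ⟨⟨x, x.2.1, hx.1, hx.2, x.2.2.2.2⟩, ⟨y, y.2.1, hy.1, hy.2, y.2.2.2.2⟩,
            ⟨z, z.2.1, hz.1, hz.2, z.2.2.2.2⟩,
            fun h => hyz (Subtype.ext (Subtype.mk.inj h)), hxy, hxz⟩ }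
  obtain ⟨x, y, z, hyz, hxy, hxz⟩ := h
  exact hS.splits hyz hxy hxz

theorem exists_embeds_of_splits {n : ℕ} {w : Equiv.Perm (Fin n)} {T B : Fin n}
    (h : Splits fun p q : {p : Fin n // T < p ∧ p < B ∧ w B < w p ∧ w p < w T} =>
      p.1 < q.1 ∧ w p < w q) :
    ∃ (m : ℕ) (u v : Equiv.Perm (Fin m)), IntervalEmbeds u v w ∧
      (InFamilyA u v ∨
        (OneLine u [2, 1, 3, 5, 4] ∧ OneLine v [5, 2, 3, 4, 1]) ∨
        (OneLine u [4, 2, 1, 6, 5, 3] ∧ OneLine v [6, 4, 2, 5, 3, 1]) ∨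
        (OneLine u [3, 2, 6, 1, 5, 4] ∧ OneLine v [6, 3, 5, 2, 4, 1])) := by
  rcases h with ⟨C, D, hC, hD, hcard, hCC, hDD, hCD, hcov⟩ | ⟨c, m, d, hcm, hmd, hcov⟩ |
    ⟨c, c', d, d', h1, h2, h3, h4, h5, h6, h7, h8, h9, h10, h11, hcov⟩
  · have hanti : ∀ E : Finset {p : Fin n // T < p ∧ p < B ∧ w B < w p ∧ w p < w T},
        (∀ e ∈ E, ∀ e' ∈ E, ¬ (e.1 < e'.1 ∧ w e < w e')) → ∀ i j, i < j →
          (E.orderEmbOfFin rfl i).1 < (E.orderEmbOfFin rfl j).1 ∧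
            w (E.orderEmbOfFin rfl j) < w (E.orderEmbOfFin rfl i) := by
      intro E hE i j hij
      have hlt : (E.orderEmbOfFin rfl i).1 < (E.orderEmbOfFin rfl j).1 :=
        (E.orderEmbOfFin rfl).strictMono hij
      refine ⟨hlt, lt_of_le_of_ne (not_lt.mp fun hw => ?_) fun hw => ?_⟩
      · exact hE _ (E.orderEmbOfFin_mem rfl i) _ (E.orderEmbOfFin_mem rfl j) ⟨hlt, hw⟩
      · exact hlt.ne' (w.injective hw)
    have hsurj : ∀ E : Finset {p : Fin n // T < p ∧ p < B ∧ w B < w p ∧ w p < w T},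
        ∀ e ∈ E, ∃ i, E.orderEmbOfFin rfl i = e := fun E e he => by
      rw [← Set.mem_range, Finset.range_orderEmbOfFin]
      exact he
    obtain ⟨m, u, v, huv, hA⟩ := exists_familyA_embeds w hC.card_pos hD.card_pos hcard T B
      (fun i => (C.orderEmbOfFin rfl i).1) (fun i => (D.orderEmbOfFin rfl i).1)
      (hanti C hCC) (hanti D hDD)
      (fun i j => hCD _ (C.orderEmbOfFin_mem rfl i) _ (D.orderEmbOfFin_mem rfl j))
      (fun i => (C.orderEmbOfFin rfl i).2) (fun i => (D.orderEmbOfFin rfl i).2)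
      (fun p q1 q2 q3 q4 => by
        rcases hcov ⟨p, q1, q2, q3, q4⟩ with hp | hp | ⟨e, he, hp⟩ | ⟨e, he, hp⟩
        · obtain ⟨i, hi⟩ := hsurj C _ hp
          exact Or.inl ⟨i, Or.inl (by rw [hi])⟩
        · obtain ⟨i, hi⟩ := hsurj D _ hp
          exact Or.inr ⟨i, Or.inl (by rw [hi])⟩
        · obtain ⟨i, rfl⟩ := hsurj C _ he
          exact Or.inl ⟨i, Or.inr hp⟩
        · obtain ⟨i, rfl⟩ := hsurj D _ he
          exact Or.inr ⟨i, Or.inr hp⟩)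
    exact ⟨m, u, v, huv, Or.inl hA⟩
  · obtain ⟨l, u, v, huv, h⟩ := exists_embeds_21354_52341 w c.2.1 hcm.1 hmd.1 d.2.2.1
      c.2.2.2.1 hcm.2 hmd.2 d.2.2.2.2
      (fun p q1 q2 q3 q4 => by simpa [Subtype.ext_iff] using hcov ⟨p, q1, q2, q3, q4⟩)
    exact ⟨l, u, v, huv, Or.inr (Or.inl h)⟩
  · have hcov' : ∀ p, T < p → p < B → w B < w p → w p < w T →
        p = c.1 ∨ p = c' ∨ p = d ∨ p = d' ∨ (p < c ∧ w p < w c) ∨ (p < c' ∧ w p < w c') ∨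
          (d < p ∧ w d < w p) ∨ (d' < p ∧ w d' < w p) := fun p q1 q2 q3 q4 => by
      simpa [Subtype.ext_iff] using hcov ⟨p, q1, q2, q3, q4⟩
    have hne : ∀ p q : Fin n, p ≠ q → w p ≠ w q := fun p q h h' => h (w.injective h')
    have e1 : c.1 ≠ c'.1 := fun h => h4 (Subtype.ext h)
    have e2 : d.1 ≠ d'.1 := fun h => h5 (Subtype.ext h)
    have e3 : c'.1 ≠ d'.1 := fun h => h6 ((Subtype.ext h : c' = d') ▸ h3)
    have f1 := hne _ _ e1
    have f2 := hne _ _ e2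
    have f3 := hne _ _ e3
    have hT := c'.2
    have hB := d'.2
    have hc := c.2
    have hd := d.2
    clear hcov hne h4 h5
    rcases lt_or_gt_of_ne e3 with hp | hp
    · obtain ⟨l, u, v, huv, h⟩ := exists_embeds_421653_642531 w (T := T) (B := B)
        (c' := c') (c := c) (d := d) (d' := d') hT.1 (by grind) h1.1 (by grind) hB.2.1
        hc.2.2.1 h3.2 (by grind) h2.2 hd.2.2.2 hcov'
      exact ⟨l, u, v, huv, Or.inr (Or.inr (Or.inl h))⟩
    · obtain ⟨l, u, v, huv, h⟩ := exists_embeds_326154_635241 w (T := T) (B := B)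
        (c' := c') (c := c) (d := d) (d' := d') hc.1 h3.1 (by grind) h2.1 hd.2.1
        hT.2.2.1 (by grind) h1.2 (by grind) hB.2.2.2 hcov'
      exact ⟨l, u, v, huv, Or.inr (Or.inr (Or.inr h))⟩

theorem HasNoninversionPath.exists_splits {n : ℕ} {w : Equiv.Perm (Fin n)} :
    ∀ (N : ℕ) (T B : Fin n), (B : ℕ) - T ≤ N → HasNoninversionPath w T B →
      ∃ T B : Fin n, Splits fun p q : {p : Fin n // T < p ∧ p < B ∧ w B < w p ∧ w p < w T} =>
        p.1 < q.1 ∧ w p < w q := by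
  intro N
  induction N with
  | zero =>
    rintro T B hN ⟨x, -⟩
    have := x.2.1.trans x.2.2.1
    rw [Fin.lt_def] at this
    omega
  | succ N ih =>
    intro T B hN h
    by_cases hmin : ∀ T' B', T ≤ T' → B' ≤ B → (T < T' ∨ B' < B) → ¬ HasNoninversionPath w T' B'
    · exact ⟨T, B, h.splits hmin⟩
    · push Not at hmin
      obtain ⟨T', B', hT, hB, hTB, h'⟩ := hmin
      obtain ⟨x, -⟩ := id h
      have hlt := x.2.1.trans x.2.2.1
      rw [Fin.le_def] at hT hB
      rw [Fin.lt_def, Fin.lt_def] at hTB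
      rw [Fin.lt_def] at hlt
      exact ih T' B' (by omega) h'

theorem Contains.hasNoninversionPath {n : ℕ} {w : Equiv.Perm (Fin n)}
    (h : Contains w [5, 3, 2, 4, 1] ∨ Contains w [5, 2, 3, 4, 1] ∨ Contains w [5, 2, 4, 3, 1]) :
    ∃ T B, HasNoninversionPath w T B := by
  have key : ∀ f : Fin 5 → Fin n, StrictMono f →
      (∃ v : Fin 5 → ℕ, (∀ j k, w (f j) < w (f k) ↔ v j < v k) ∧
        (v = ![5, 3, 2, 4, 1] ∨ v = ![5, 2, 3, 4, 1] ∨ v = ![5, 2, 4, 3, 1])) →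
      ∃ T B, HasNoninversionPath w T B := by
    rintro f hf ⟨v, hv, hcases⟩
    refine ⟨f 0, f 4, ?_⟩
    have hbox : ∀ j : Fin 5, 0 < j → j < 4 →
        f 0 < f j ∧ f j < f 4 ∧ w (f 4) < w (f j) ∧ w (f j) < w (f 0) := by
      intro j h0 h4
      refine ⟨hf h0, hf h4, ?_, ?_⟩ <;> rw [hv] <;> revert j <;>
        rcases hcases with rfl | rfl | rfl <;> decide
    have hp : ∀ x y z : Fin 5, 0 < x → x < 4 → 0 < y → y < 4 → 0 < z → z < 4 → y ≠ z →
        ((x < y ∧ v x < v y) ∨ (y < x ∧ v y < v x)) →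
        ((x < z ∧ v x < v z) ∨ (z < x ∧ v z < v x)) → HasNoninversionPath w (f 0) (f 4) := by
      intro x y z x0 x4 y0 y4 z0 z4 hyz hxy hxz
      refine ⟨⟨f x, hbox x x0 x4⟩, ⟨f y, hbox y y0 y4⟩, ⟨f z, hbox z z0 z4⟩,
        fun h => hyz (hf.injective (congrArg Subtype.val h)), ?_, ?_⟩ <;>
      simpa only [hv, hf.lt_iff_lt]
    rcases hcases with rfl | rfl | rfl
    · exact hp 3 1 2 (by decide) (by decide) (by decide) (by decide) (by decide) (by decide)
        (by decide) (by decide) (by decide)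
    · exact hp 2 1 3 (by decide) (by decide) (by decide) (by decide) (by decide) (by decide)
        (by decide) (by decide) (by decide)
    · exact hp 1 2 3 (by decide) (by decide) (by decide) (by decide) (by decide) (by decide)
        (by decide) (by decide) (by decide)
  rcases h with ⟨f, hf, hv⟩ | ⟨f, hf, hv⟩ | ⟨f, hf, hv⟩
  · exact key f hf ⟨_, hv, Or.inl (by decide)⟩
  · exact key f hf ⟨_, hv, Or.inr (Or.inl (by decide))⟩
  · exact key f hf ⟨_, hv, Or.inr (Or.inr (by decide))⟩

theorem IntervalEmbeds.contains {m n : ℕ} {u v : Equiv.Perm (Fin m)} {w : Equiv.Perm (Fin n)}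
    (h : IntervalEmbeds u v w) (L : List ℕ) (i : Fin L.length → ℕ) (hi : StrictMono i)
    (hpos : ∀ j, 1 ≤ i j ∧ i j ≤ m)
    (hL : ∀ j k, pval v (i j) < pval v (i k) ↔ L.get j < L.get k) : Contains w L := by
  obtain ⟨-, f, x, hf, hw, -⟩ := h
  refine ⟨fun j => f ⟨i j - 1, by have := hpos j; omega⟩, fun j k hjk => hf ?_, fun j k => ?_⟩
  · have h1 := hi hjk
    have h2 := hpos j
    rw [Fin.mk_lt_mk]
    omega
  · rw [hw, ← hL, pval, pval, dif_pos (hpos j), dif_pos (hpos k), Fin.lt_def]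
    omega

theorem contains_of_inFamilyA {m n : ℕ} {u v : Equiv.Perm (Fin m)} {w : Equiv.Perm (Fin n)}
    (h : IntervalEmbeds u v w) (hA : InFamilyA u v) :
    Contains w [5, 3, 2, 4, 1] ∨ Contains w [5, 2, 4, 3, 1] := by
  obtain ⟨a, b, ha, hb, hab, rfl, -, -, v1, v2, v3, v4⟩ := hA
  by_cases ha2 : 2 ≤ a
  · refine Or.inl (h.contains _ ![1, 2, 3, a + 2, a + b + 2] ?_ ?_ ?_)
    · simp [strictMono_vecCons]
      omega
    · intro j
      fin_cases j <;> (simp; try omega)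
    · have e1 := v2 2 (by omega) (by omega)
      have e2 := v2 3 (by omega) (by omega)
      have e3 := v3 (a + 2) (by omega) (by omega)
      intro j k
      fin_cases j <;> fin_cases k <;> simp [v1, v4, e1, e2, e3] <;> omega
  · refine Or.inr (h.contains _ ![1, 2, a + 2, a + 3, a + b + 2] ?_ ?_ ?_)
    · simp [strictMono_vecCons]
      omega
    · intro j
      fin_cases j <;> (simp; try omega)
    · have e1 := v2 2 (by omega) (by omega)
      have e2 := v3 (a + 2) (by omega) (by omega)
      have e3 := v3 (a + 3) (by omega) (by omega)
      intro j k
      fin_cases j <;> fin_cases k <;> simp [v1, v4, e1, e2, e3] <;> omega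

theorem IntervalEmbeds.contains_of_oneLine {m n : ℕ} {u v : Equiv.Perm (Fin m)}
    {w : Equiv.Perm (Fin n)} (h : IntervalEmbeds u v w) {V : List ℕ} (hV : OneLine v V)
    (L : List ℕ) (i : Fin L.length → Fin V.length) (hi : StrictMono i)
    (hL : ∀ j k, V.get (i j) < V.get (i k) ↔ L.get j < L.get k) : Contains w L := by
  obtain ⟨hm, hv⟩ := hV
  refine h.contains L (fun j => i j + 1) (fun j k hjk => Nat.succ_lt_succ (hi hjk))
    (fun j => ⟨by simp, by rw [hm]; exact (i j).isLt⟩) fun j k => ?_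
  rw [hv _ (i j).isLt, hv _ (i k).isLt]
  exact hL j k

/-- A permutation contains one of the patterns 53241, 52341, 52431 if and only if one of
the following interval patterns embeds in it:  a member of family A, `[21354, 52341]`,
`[421653, 642531]`, or `[326154, 635241]`. -/
theorem contains_iff_interval_embeds {n : ℕ} (w : Equiv.Perm (Fin n)) :
    (Contains w [5, 3, 2, 4, 1] ∨ Contains w [5, 2, 3, 4, 1] ∨
        Contains w [5, 2, 4, 3, 1]) ↔
      ∃ (m : ℕ) (u v : Equiv.Perm (Fin m)), IntervalEmbeds u v w ∧
        (InFamilyA u v ∨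
          (OneLine u [2, 1, 3, 5, 4] ∧ OneLine v [5, 2, 3, 4, 1]) ∨
          (OneLine u [4, 2, 1, 6, 5, 3] ∧ OneLine v [6, 4, 2, 5, 3, 1]) ∨
          (OneLine u [3, 2, 6, 1, 5, 4] ∧ OneLine v [6, 3, 5, 2, 4, 1])) := by
  constructor
  · intro h
    obtain ⟨T, B, hTB⟩ := Contains.hasNoninversionPath h
    obtain ⟨T', B', hs⟩ := hTB.exists_splits _ T B le_rfl
    exact exists_embeds_of_splits hs
  · rintro ⟨m, u, v, h, hA | ⟨-, hv⟩ | ⟨-, hv⟩ | ⟨-, hv⟩⟩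
    · rcases contains_of_inFamilyA h hA with h1 | h1
      · exact Or.inl h1
      · exact Or.inr (Or.inr h1)
    · exact Or.inr (Or.inl (h.contains_of_oneLine hv _ id strictMono_id fun _ _ => Iff.rfl))
    · exact Or.inl (h.contains_of_oneLine hv _ (![0, 1, 2, 3, 5] : Fin 5 → Fin 6)
        (by decide) (by decide))
    · exact Or.inl (h.contains_of_oneLine hv _ (![0, 1, 3, 4, 5] : Fin 5 → Fin 6)
        (by decide) (by decide))
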